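/- arXiv:2303.04892 — 3 statements merged into one kernel-verified Lean document; each statement's English description precedes it below -/
import Mathlib

section
/- For every natural number n > 10, the supremum of the growth factor over all completely pivoted real n×n matrices satisfies g[CP_n(ℝ)] ≥ 1.0045·n. -/
open scoped BigOperators

/-- `geIter A k` is the Gaussian elimination iterate `A^{(k+1)}` (0-indexed, `geIter A 0 = A`).
Entries with row or column index `< k` are left unchanged; they are irrelevant. -/
noncomputable def geIter {𝕜 : Type*} [Field 𝕜] {n : ℕ} (A : Matrix (Fin n) (Fin n) 𝕜) :
    ℕ → Matrix (Fin n) (Fin n) 𝕜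
  | 0 => A
  | k + 1 => fun i j =>
    if h : k < n ∧ k + 1 ≤ i.1 ∧ k + 1 ≤ j.1 then
      geIter A k i j -
        geIter A k i ⟨k, h.1⟩ * geIter A k ⟨k, h.1⟩ j / geIter A k ⟨k, h.1⟩ ⟨k, h.1⟩
    else geIter A k i j

/-- The norm of the pivot `a^{(k+1)}_{k,k}` (0-indexed). -/
noncomputable def pivotNorm {𝕜 : Type*} [RCLike 𝕜] {n : ℕ}
    (A : Matrix (Fin n) (Fin n) 𝕜) (k : ℕ) : ℝ :=
  if h : k < n then ‖geIter A k ⟨k, h⟩ ⟨k, h⟩‖ else 0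

/-- The growth factor `g(A)`. -/
noncomputable def growth {𝕜 : Type*} [RCLike 𝕜] {n : ℕ} (A : Matrix (Fin n) (Fin n) 𝕜) : ℝ :=
  (⨆ k : Fin n, ⨆ i : Fin n, ⨆ j : Fin n,
      if k.1 ≤ i.1 ∧ k.1 ≤ j.1 then ‖geIter A k.1 i j‖ else 0) /
    ⨆ i : Fin n, ⨆ j : Fin n, ‖A i j‖

/-- `A` is completely pivoted: `A ∈ CP_n(𝕜)`. -/
def IsCP {𝕜 : Type*} [RCLike 𝕜] {n : ℕ} (A : Matrix (Fin n) (Fin n) 𝕜) : Prop :=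
  A.det ≠ 0 ∧ (∀ k : ℕ, k + 1 < n → pivotNorm A k ≠ 0) ∧
    ∀ (k : ℕ) (i j : Fin n), k ≤ i.1 → k ≤ j.1 → ‖geIter A k i j‖ ≤ pivotNorm A k

/-- `g[CP_n(𝕜)]`. -/
noncomputable def gCP (𝕜 : Type*) [RCLike 𝕜] (n : ℕ) : ℝ :=
  sSup (growth '' {A : Matrix (Fin n) (Fin n) 𝕜 | IsCP A})


/-! ### Completely pivoted matrices, recursively -/

/-- One elimination step, followed by deleting the first row and column. -/
noncomputable def sh (M : ℕ → ℕ → ℝ) : ℕ → ℕ → ℝ :=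
  fun i j => M (i + 1) (j + 1) - M (i + 1) 0 * M 0 (j + 1) / M 0 0

/-- The leading `n × n` block is completely pivoted and its last pivot is at least `c`. -/
def Good (c : ℝ) : ℕ → (ℕ → ℕ → ℝ) → Prop
  | 0, _ => False
  | 1, M => M 0 0 ≠ 0 ∧ c ≤ |M 0 0|
  | n + 2, M => M 0 0 ≠ 0 ∧ (∀ i j, i < n + 2 → j < n + 2 → |M i j| ≤ |M 0 0|) ∧
      Good c (n + 1) (sh M)

/-- There is a completely pivoted `n × n` matrix with growth at least `g`. -/
def HasG (n : ℕ) (g : ℝ) : Prop := ∃ M, Good (g * |M 0 0|) n M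

theorem HasG.mono {n : ℕ} {g g' : ℝ} (h : HasG n g) (hg : g' ≤ g) : HasG n g' := by
  obtain ⟨M, hM⟩ := h
  refine ⟨M, ?_⟩
  have hc : g' * |M 0 0| ≤ g * |M 0 0| := by gcongr
  generalize g' * |M 0 0| = c' at *
  generalize g * |M 0 0| = c at *
  induction n using Nat.strong_induction_on generalizing M with
  | _ n ih =>
    match n, hM with
    | 1, hM => exact ⟨hM.1, hc.trans hM.2⟩
    | n + 2, hM => exact ⟨hM.1, hM.2.1, ih (n + 1) (by omega) _ hM.2.2⟩

theorem Good.pos {c : ℝ} {n : ℕ} {M : ℕ → ℕ → ℝ} (h : Good c n M) : 0 < n := by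
  cases n with
  | zero => exact h.elim
  | succ n => omega

theorem Good.ne {c : ℝ} {n : ℕ} {M : ℕ → ℕ → ℝ} (h : Good c n M) : M 0 0 ≠ 0 := by
  match n, h with
  | 1, h => exact h.1
  | n + 2, h => exact h.1

theorem Good.le {c : ℝ} {n : ℕ} {M : ℕ → ℕ → ℝ} (h : Good c n M) (i j : ℕ) (hi : i < n)
    (hj : j < n) : |M i j| ≤ |M 0 0| := by
  match n, h with
  | 1, h =>
    obtain rfl : i = 0 := by omega
    obtain rfl : j = 0 := by omega
    exact le_rfl
  | n + 2, h => exact h.2.1 i j hi hj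

/-- Adding one dimension. -/
theorem HasG.succ {n : ℕ} {g : ℝ} (h : HasG n g) : HasG (n + 1) g := by
  obtain ⟨M, hM⟩ := h
  obtain ⟨m, rfl⟩ : ∃ m, n = m + 1 := ⟨n - 1, by have := hM.pos; omega⟩
  let X : ℕ → ℕ → ℝ := fun i j =>
    match i, j with
    | 0, 0 => M 0 0
    | 0, _ + 1 => 0
    | _ + 1, 0 => 0
    | i + 1, j + 1 => M i j
  have hX : sh X = M := by
    funext i j
    simp [sh, X]
  refine ⟨X, hM.ne, ?_, ?_⟩
  · intro i j hi hj
    match i, j with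
    | 0, 0 => exact le_rfl
    | 0, _ + 1 => simp [X]
    | _ + 1, 0 => simp [X]
    | i + 1, j + 1 => exact hM.le i j (by omega) (by omega)
  · rw [hX]
    exact hM

/-- Tensoring with the `2 × 2` Hadamard matrix. -/
noncomputable def dbl (M : ℕ → ℕ → ℝ) : ℕ → ℕ → ℝ :=
  fun i j => if i % 2 = 1 ∧ j % 2 = 1 then - M (i / 2) (j / 2) else M (i / 2) (j / 2)

theorem sh_sh_dbl (M : ℕ → ℕ → ℝ) (h : M 0 0 ≠ 0) : sh (sh (dbl M)) = dbl (sh M) := by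
  funext i j
  have e1 : (i + 1 + 1) / 2 = i / 2 + 1 := by omega
  have e2 : (j + 1 + 1) / 2 = j / 2 + 1 := by omega
  have e3 : (i + 1 + 1) % 2 = i % 2 := by omega
  have e4 : (j + 1 + 1) % 2 = j % 2 := by omega
  have e5 : -M 0 0 - M 0 0 ≠ 0 := by
    intro h'
    apply h
    linarith
  rcases Nat.mod_two_eq_zero_or_one i with hi | hi <;>
  rcases Nat.mod_two_eq_zero_or_one j with hj | hj <;>
  simp [sh, dbl, e1, e2, e3, e4, hi, hj] <;>
  field_simp <;> first | ring1 | (ring_nf; simp)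

theorem abs_mul_div_le {a b p : ℝ} (ha : |a| ≤ |p|) (hb : |b| ≤ |p|) : |a * b / p| ≤ |p| := by
  by_cases hp : p = 0
  · simp [hp]
  · have : 0 < |p| := abs_pos.mpr hp
    rw [abs_div, abs_mul, div_le_iff₀ this]
    exact mul_le_mul ha hb (abs_nonneg _) (abs_nonneg _)

theorem abs_dbl (M : ℕ → ℕ → ℝ) (i j : ℕ) : |dbl M i j| = |M (i / 2) (j / 2)| := by
  unfold dbl
  split_ifs <;> simp

theorem Good.dbl {c : ℝ} {n : ℕ} {M : ℕ → ℕ → ℝ} (h : Good c n M) :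
    Good (2 * c) (2 * n) (dbl M) := by
  induction n using Nat.strong_induction_on generalizing M with
  | _ n ih =>
    obtain ⟨m, rfl⟩ : ∃ m, n = m + 1 := ⟨n - 1, by have := h.pos; omega⟩
    have h0 := h.ne
    have hd : _root_.dbl M 0 0 = M 0 0 := by simp [_root_.dbl]
    have hp : sh (_root_.dbl M) 0 0 = - 2 * M 0 0 := by
      simp [sh, _root_.dbl]
      field_simp
      ring
    have hle : ∀ i j, i < 2 * (m + 1) → j < 2 * (m + 1) →
        |_root_.dbl M i j| ≤ |_root_.dbl M 0 0| := by
      intro i j hi hj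
      rw [abs_dbl, abs_dbl]
      exact h.le _ _ (by omega) (by omega)
    refine ⟨by rwa [hd], hle, ?_⟩
    match m, h with
    | 0, h =>
      refine ⟨by simp [hp, h0], ?_⟩
      rw [hp, abs_mul]
      have := h.2
      norm_num
      exact this
    | k + 1, h =>
      refine ⟨by simp [hp, h0], ?_, ?_⟩
      · intro i j hi hj
        replace hi : i < 2 * (k + 1) + 1 := hi
        replace hj : j < 2 * (k + 1) + 1 := hj
        rw [hp, abs_mul]
        unfold sh
        refine (abs_sub _ _).trans ?_
        have t1 := hle (i + 1) (j + 1) (by omega) (by omega)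
        have t2 := abs_mul_div_le (hle (i + 1) 0 (by omega) (by omega))
          (hle 0 (j + 1) (by omega) (by omega))
        rw [hd] at t1 t2
        norm_num
        rw [hd]
        linarith
      · rw [sh_sh_dbl M h0]
        exact ih (k + 1) (by omega) h.2.2

theorem HasG.double {n : ℕ} {g : ℝ} (h : HasG n g) : HasG (2 * n) (2 * g) := by
  obtain ⟨M, hM⟩ := h
  refine ⟨dbl M, ?_⟩
  have := hM.dbl
  rwa [abs_dbl, mul_assoc]

/-! ### The integer checker (fraction-free elimination) -/

/-- Fraction-free elimination of one row `r :: rs` against the pivot row `p :: u`. -/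
def elimRow (d p : ℤ) (u : List ℤ) : List ℤ → List ℤ
  | [] => []
  | r :: rs => List.zipWith (fun x y => (p * y - r * x) / d) u rs

/-- All divisions in `elimRow` are exact. -/
def exactRow (d p : ℤ) (u : List ℤ) : List ℤ → Bool
  | [] => true
  | r :: rs => (List.zipWith (fun x y => (p * y - r * x) % d == 0) u rs).all id

def check (tn td : ℕ) : ℕ → ℤ → List (List ℤ) → Bool
  | 0, _, _ => false
  | 1, d, L =>
    match L with
    | (z :: _) :: _ => !(Nat.beq z.natAbs 0) && Nat.ble (tn * d.natAbs) (td * z.natAbs)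
    | _ => false
  | n + 2, d, L =>
    match L with
    | (p :: u) :: rest =>
      !(Nat.beq p.natAbs 0) &&
      (((p :: u) :: rest).all fun row => row.all fun x => Nat.ble x.natAbs p.natAbs) &&
      (rest.all fun row => exactRow d p u row) &&
      check tn td (n + 1) p (rest.map fun row => elimRow d p u row)
    | _ => false

/-- The integer table `L` divided by `d` represents the leading block of `M`. -/
def IntRep (n : ℕ) (d : ℤ) (L : List (List ℤ)) (M : ℕ → ℕ → ℝ) : Prop :=
  ∀ i j, i < n → j < n → ∃ row, L[i]? = some row ∧ ∃ z, row[j]? = some z ∧ M i j = z / d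

theorem natAbs_ble {x p : ℤ} (h : Nat.ble x.natAbs p.natAbs = true) : |(x : ℝ)| ≤ |(p : ℝ)| := by
  have := Nat.le_of_ble_eq_true h
  rw [← Int.cast_abs, ← Int.cast_abs]
  have h' : |x| ≤ |p| := by
    rw [Int.abs_eq_natAbs, Int.abs_eq_natAbs]
    exact_mod_cast this
  exact_mod_cast h'

theorem check_sound (tn td : ℕ) (htd : 0 < td) (n : ℕ) (d : ℤ) (L : List (List ℤ))
    (M : ℕ → ℕ → ℝ) (hd : d ≠ 0) (hR : IntRep n d L M) (hc : check tn td n d L = true) :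
    Good ((tn : ℝ) / td) n M := by
  induction n using Nat.strong_induction_on generalizing d L M with
  | _ n ih =>
    have hdR : (d : ℝ) ≠ 0 := by exact_mod_cast hd
    match n, L, hc with
    | 1, (z :: zs) :: rest, hc =>
      simp only [check, Bool.and_eq_true, Bool.not_eq_true'] at hc
      obtain ⟨h1, h2⟩ := hc
      have hz : z ≠ 0 := by
        rintro rfl
        simp at h1
      have hzR : (z : ℝ) ≠ 0 := by exact_mod_cast hz
      obtain ⟨row, hrow, w, hw, hM⟩ := hR 0 0 (by omega) (by omega)
      simp at hrow
      subst hrow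
      simp at hw
      subst hw
      refine ⟨by rw [hM]; exact div_ne_zero hzR hdR, ?_⟩
      have h3 := Nat.le_of_ble_eq_true h2
      have h4 : (tn : ℝ) * |(d : ℝ)| ≤ td * |(z : ℝ)| := by
        have : ((tn * d.natAbs : ℕ) : ℝ) ≤ ((td * z.natAbs : ℕ) : ℝ) := by exact_mod_cast h3
        push_cast [Nat.cast_natAbs] at this
        exact this
      rw [hM, abs_div]
      have : (0 : ℝ) < td := by exact_mod_cast htd
      have hd' : 0 < |(d : ℝ)| := abs_pos.mpr hdR
      rw [div_le_div_iff₀ this hd']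
      linarith
    | m + 2, (p :: u) :: rest, hc =>
      simp only [check, Bool.and_eq_true, Bool.not_eq_true'] at hc
      obtain ⟨⟨⟨h1, h2⟩, h3⟩, h4⟩ := hc
      have hp : p ≠ 0 := by
        rintro rfl
        simp at h1
      have hpR : (p : ℝ) ≠ 0 := by exact_mod_cast hp
      have h00 : M 0 0 = p / d := by
        obtain ⟨row, hrow, w, hw, hM⟩ := hR 0 0 (by omega) (by omega)
        simp at hrow
        subst hrow
        simp at hw
        subst hw
        exact hM
      refine ⟨by rw [h00]; exact div_ne_zero hpR hdR, ?_, ?_⟩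
      · intro i j hi hj
        obtain ⟨row, hrow, w, hw, hM⟩ := hR i j hi hj
        rw [List.all_eq_true] at h2
        have h5 := h2 row (List.mem_of_getElem? hrow)
        rw [List.all_eq_true] at h5
        have h6 := natAbs_ble (h5 w (List.mem_of_getElem? hw))
        rw [hM, h00, abs_div, abs_div]
        gcongr
      · refine ih (m + 1) (by omega) p _ _ hp ?_ h4
        intro i j hi hj
        obtain ⟨row, hrow, y, hy, hMy⟩ := hR (i + 1) (j + 1) (by omega) (by omega)
        obtain ⟨row', hrow', r, hr, hMr⟩ := hR (i + 1) 0 (by omega) (by omega)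
        obtain ⟨row'', hrow'', x, hx, hMx⟩ := hR 0 (j + 1) (by omega) (by omega)
        rw [hrow] at hrow'
        obtain rfl := Option.some.inj hrow'
        simp at hrow''
        subst hrow''
        simp at hrow hx
        match row, hr with
        | r' :: rs, hr =>
          simp at hr hy
          subst hr
          refine ⟨elimRow d p u (r' :: rs), by simp [hrow], (p * y - r' * x) / d,
            by simp [elimRow, List.getElem?_zipWith, hx, hy], ?_⟩
          rw [List.all_eq_true] at h3
          have h5 := h3 _ (List.mem_of_getElem? hrow)
          simp only [exactRow] at h5
          rw [List.all_eq_true] at h5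
          have h6 := h5 ((p * y - r' * x) % d == 0)
            (List.mem_of_getElem? (i := j) (by simp [List.getElem?_zipWith, hx, hy]))
          have h7 : d ∣ p * y - r' * x := by
            apply Int.dvd_of_emod_eq_zero
            simpa using h6
          have h8 : (((p * y - r' * x) / d : ℤ) : ℝ) = ((p : ℝ) * y - r' * x) / d := by
            rw [Int.cast_div h7 hdR]
            push_cast
            rfl
          rw [h8]
          unfold sh
          rw [h00, hMy, hMr, hMx]
          field_simp

def sizeOk (n : ℕ) (L : List (List ℤ)) : Bool :=
  Nat.beq L.length n && L.all fun row => Nat.beq row.length n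

theorem hasG_of_check (n : ℕ) (L : List (List ℤ)) (a num den : ℕ) (hden : 0 < den)
    (hs : sizeOk n L = true) (ha : (L[0]?.getD [])[0]?.getD 0 = (a : ℤ))
    (hc : check (num * a) den n 1 L = true) : HasG n ((num : ℝ) / den) := by
  let M : ℕ → ℕ → ℝ := fun i j => (((L[i]?.getD [])[j]?.getD 0 : ℤ) : ℝ)
  have hM : M 0 0 = a := by
    simp only [M, ha]
    simp
  refine ⟨M, ?_⟩
  have key := check_sound (num * a) den hden n 1 L M one_ne_zero ?_ hc
  · rw [hM]
    convert key using 1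
    push_cast
    rw [Nat.abs_cast]
    ring
  · intro i j hi hj
    simp only [sizeOk, Bool.and_eq_true, List.all_eq_true] at hs
    obtain ⟨h1, h2⟩ := hs
    have h1 := Nat.eq_of_beq_eq_true h1
    have hi' : i < L.length := by omega
    have h3 := Nat.eq_of_beq_eq_true (h2 L[i] (List.getElem_mem hi'))
    have hj' : j < L[i].length := by omega
    refine ⟨L[i], List.getElem?_eq_getElem hi', L[i][j], List.getElem?_eq_getElem hj', ?_⟩
    simp [M, List.getElem?_eq_getElem hi', List.getElem?_eq_getElem hj']

/-! ### Link with the growth factor -/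

/-- Iterated elimination without deletion. -/
noncomputable def gs (M : ℕ → ℕ → ℝ) : ℕ → ℕ → ℕ → ℝ
  | 0 => M
  | k + 1 => fun i j => gs M k i j - gs M k i k * gs M k k j / gs M k k k

theorem gs_succ (M : ℕ → ℕ → ℝ) (k i j : ℕ) :
    gs M (k + 1) i j = gs M k i j - gs M k i k * gs M k k j / gs M k k k := rfl

theorem geIter_succ {n : ℕ} (A : Matrix (Fin n) (Fin n) ℝ) (k : ℕ) (hk : k < n) (i j : Fin n)
    (hi : k + 1 ≤ i.1) (hj : k + 1 ≤ j.1) :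
    geIter A (k + 1) i j = geIter A k i j -
      geIter A k i ⟨k, hk⟩ * geIter A k ⟨k, hk⟩ j / geIter A k ⟨k, hk⟩ ⟨k, hk⟩ :=
  dif_pos (⟨hk, hi, hj⟩ : k < n ∧ k + 1 ≤ i.1 ∧ k + 1 ≤ j.1)

theorem gs_sh (M : ℕ → ℕ → ℝ) (k i j : ℕ) : gs M (k + 1) (i + 1) (j + 1) = gs (sh M) k i j := by
  induction k generalizing i j with
  | zero => rfl
  | succ k ih =>
    rw [gs_succ M (k + 1), gs_succ (sh M) k, ih, ih, ih, ih]

theorem Good.gs {c : ℝ} {n : ℕ} {M : ℕ → ℕ → ℝ} (h : Good c n M) (k : ℕ) (hk : k < n) :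
    gs M k k k ≠ 0 ∧ ∀ i j, k ≤ i → k ≤ j → i < n → j < n → |gs M k i j| ≤ |gs M k k k| := by
  induction n generalizing M k with
  | zero => omega
  | succ n ih =>
    cases k with
    | zero => exact ⟨h.ne, fun i j _ _ hi hj => h.le i j hi hj⟩
    | succ k =>
      match n, h with
      | 0, _ => omega
      | m + 1, h =>
        obtain ⟨h1, h2⟩ := ih h.2.2 k (by omega)
        rw [gs_sh]
        refine ⟨h1, ?_⟩
        intro i j hi hj hi' hj'
        obtain ⟨i, rfl⟩ : ∃ i', i = i' + 1 := ⟨i - 1, by omega⟩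
        obtain ⟨j, rfl⟩ : ∃ j', j = j' + 1 := ⟨j - 1, by omega⟩
        rw [gs_sh]
        exact h2 i j (by omega) (by omega) (by omega) (by omega)

theorem Good.last {c : ℝ} {n : ℕ} {M : ℕ → ℕ → ℝ} (h : Good c (n + 1) M) :
    c ≤ |_root_.gs M n n n| := by
  induction n generalizing M with
  | zero => exact h.2
  | succ n ih =>
    rw [gs_sh]
    exact ih h.2.2

theorem geIter_eq_gs {n : ℕ} (M : ℕ → ℕ → ℝ) (A : Matrix (Fin n) (Fin n) ℝ)
    (hA : ∀ a b : Fin n, A a b = M a b) (k : ℕ) (i j : Fin n) (hi : k ≤ i.1) (hj : k ≤ j.1) :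
    geIter A k i j = gs M k i j := by
  induction k generalizing i j with
  | zero => exact hA i j
  | succ k ih =>
    have hk : k < n := by have := i.2; omega
    rw [geIter_succ _ k hk i j hi hj, ih i j (by omega) (by omega),
      ih i ⟨k, hk⟩ (by omega) le_rfl, ih ⟨k, hk⟩ j le_rfl (by omega),
      ih ⟨k, hk⟩ ⟨k, hk⟩ le_rfl le_rfl, gs_succ]

/-- The determinant does not vanish when the pivots do not. -/
theorem det_ne_zero_of_pivots {n : ℕ} (M : ℕ → ℕ → ℝ) (h : ∀ k < n, gs M k k k ≠ 0) :
    Matrix.det (fun a b : Fin n => M a b : Matrix (Fin n) (Fin n) ℝ) ≠ 0 := by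
  let L : Matrix (Fin n) (Fin n) ℝ := fun i k =>
    if k ≤ i then gs M k i k / gs M k k k else 0
  let U : Matrix (Fin n) (Fin n) ℝ := fun k j => if k ≤ j then gs M k k j else 0
  have hLU : (fun a b : Fin n => M a b : Matrix (Fin n) (Fin n) ℝ) = L * U := by
    funext i j
    rw [Matrix.mul_apply]
    have e1 : ∀ k : Fin n, L i k * U k j =
        (fun k : ℕ => if k ≤ i.1 ∧ k ≤ j.1 then gs M k i j - gs M (k + 1) i j else 0) k.1 := by
      intro k
      by_cases h1 : k ≤ i <;> by_cases h2 : k ≤ j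
      · have h1' : k.1 ≤ i.1 := h1
        have h2' : k.1 ≤ j.1 := h2
        simp only [L, U, h1, h2, h1', h2', if_true, and_self, gs]
        ring
      · have h2' : ¬ k.1 ≤ j.1 := h2
        simp [U, h2, h2']
      · have h1' : ¬ k.1 ≤ i.1 := h1
        simp [L, h1, h1']
      · have h1' : ¬ k.1 ≤ i.1 := h1
        simp [L, h1, h1']
    rw [Finset.sum_congr rfl (fun k _ => e1 k),
      Fin.sum_univ_eq_sum_range
        (fun k : ℕ => if k ≤ i.1 ∧ k ≤ j.1 then gs M k i j - gs M (k + 1) i j else 0) n]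
    have hm : min i.1 j.1 + 1 ≤ n := by have := i.2; omega
    rw [← Finset.sum_subset (Finset.range_subset_range.mpr hm)]
    · rw [Finset.sum_congr rfl (g := fun k => gs M k i j - gs M (k + 1) i j),
        Finset.sum_range_sub']
      · have h0 : gs M (min i.1 j.1 + 1) i j = 0 := by
          rw [gs_succ]
          rcases le_total i.1 j.1 with hij | hij
          · rw [min_eq_left hij]
            have := h i.1 i.2
            field_simp
            ring
          · rw [min_eq_right hij]
            have := h j.1 j.2
            field_simp
            ring
        rw [h0]
        simp [gs]
      · intro k hk
        rw [Finset.mem_range] at hk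
        rw [if_pos (by omega)]
    · intro k _ hk
      rw [Finset.mem_range] at hk
      rw [if_neg (by omega)]
  rw [hLU, Matrix.det_mul]
  apply mul_ne_zero
  · rw [Matrix.det_of_isLowerTriangular]
    · rw [Finset.prod_ne_zero_iff]
      intro i _
      simp [L, h i.1 i.2]
    · intro i j hij
      have : ¬ j ≤ i := not_le.mpr (by simpa using hij)
      simp [L, this]
  · rw [Matrix.det_of_isUpperTriangular]
    · rw [Finset.prod_ne_zero_iff]
      intro i _
      simp [U, h i.1 i.2]
    · intro i j hij
      have : ¬ i ≤ j := not_le.mpr (by simpa using hij)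
      simp [U, this]

theorem le_sup2 {n : ℕ} (f : Fin n → Fin n → ℝ) (i j : Fin n) :
    f i j ≤ ⨆ i : Fin n, ⨆ j : Fin n, f i j :=
  (le_ciSup (f := fun j => f i j) (Set.finite_range _).bddAbove j).trans
    (le_ciSup (f := fun i => ⨆ j, f i j) (Set.finite_range _).bddAbove i)

theorem geIter_bound {n : ℕ} (A : Matrix (Fin n) (Fin n) ℝ) (hA : IsCP A) (k : ℕ) (i j : Fin n)
    (hi : k ≤ i.1) (hj : k ≤ j.1) :
    ‖geIter A k i j‖ ≤ 2 ^ k * ⨆ i : Fin n, ⨆ j : Fin n, ‖A i j‖ := by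
  induction k generalizing i j with
  | zero => simpa [geIter] using le_sup2 (fun i j => ‖A i j‖) i j
  | succ k ih =>
    have hk : k < n := by have := i.2; omega
    rw [geIter_succ A k hk i j hi hj]
    have h1 := ih i j (by omega) (by omega)
    have h2 := hA.2.2 k i ⟨k, hk⟩ (by omega) le_rfl
    have h3 := hA.2.2 k ⟨k, hk⟩ j le_rfl (by omega)
    rw [pivotNorm, dif_pos hk] at h2 h3
    have h4 := ih ⟨k, hk⟩ ⟨k, hk⟩ le_rfl le_rfl
    have h5 := abs_mul_div_le h2 h3
    refine (norm_sub_le _ _).trans ?_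
    rw [Real.norm_eq_abs (_ / _)]
    rw [Real.norm_eq_abs (geIter A k ⟨k, hk⟩ ⟨k, hk⟩)] at h4
    rw [pow_succ]
    linarith

theorem growth_bdd (n : ℕ) :
    BddAbove (growth '' {A : Matrix (Fin n) (Fin n) ℝ | IsCP A}) := by
  refine ⟨2 ^ n, ?_⟩
  rintro _ ⟨A, hA, rfl⟩
  have hD : 0 ≤ ⨆ i : Fin n, ⨆ j : Fin n, ‖A i j‖ :=
    Real.iSup_nonneg fun i => Real.iSup_nonneg fun j => norm_nonneg _
  unfold growth
  apply div_le_of_le_mul₀ hD (by positivity)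
  have hnn : 0 ≤ 2 ^ n * ⨆ i : Fin n, ⨆ j : Fin n, ‖A i j‖ := by positivity
  refine Real.iSup_le (fun k => Real.iSup_le (fun i => Real.iSup_le (fun j => ?_) hnn) hnn) hnn
  split_ifs with h
  · refine (geIter_bound A hA k i j h.1 h.2).trans ?_
    gcongr
    · norm_num
    · exact k.2.le
  · exact hnn

theorem HasG.le_gCP {n : ℕ} {g : ℝ} (hg : 0 ≤ g) (h : HasG n g) : g ≤ gCP ℝ n := by
  obtain ⟨M, hM⟩ := h
  obtain ⟨m, rfl⟩ : ∃ m, n = m + 1 := ⟨n - 1, by have := hM.pos; omega⟩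
  let A : Matrix (Fin (m + 1)) (Fin (m + 1)) ℝ := fun a b => M a b
  have hit : ∀ (k : ℕ) (i j : Fin (m + 1)), k ≤ i.1 → k ≤ j.1 → geIter A k i j = gs M k i j :=
    geIter_eq_gs M A fun _ _ => rfl
  have hpiv : ∀ k, k < m + 1 → pivotNorm A k = |gs M k k k| := by
    intro k hk
    rw [pivotNorm, dif_pos hk, hit k ⟨k, hk⟩ ⟨k, hk⟩ le_rfl le_rfl, Real.norm_eq_abs]
  have hCP : IsCP A := by
    refine ⟨det_ne_zero_of_pivots M fun k hk => (hM.gs k hk).1, ?_, ?_⟩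
    · intro k hk
      rw [hpiv k (by omega)]
      exact abs_ne_zero.mpr (hM.gs k (by omega)).1
    · intro k i j hi hj
      have hk : k < m + 1 := by have := i.2; omega
      rw [hpiv k hk, hit k i j hi hj, Real.norm_eq_abs]
      exact (hM.gs k hk).2 i j hi hj i.2 j.2
  refine le_trans ?_ (le_csSup (growth_bdd (m + 1)) ⟨A, hCP, rfl⟩)
  have hD : (⨆ i : Fin (m + 1), ⨆ j : Fin (m + 1), ‖A i j‖) ≤ |M 0 0| :=
    ciSup_le fun i => ciSup_le fun j => hM.le i j i.2 j.2
  have hD0 : 0 < ⨆ i : Fin (m + 1), ⨆ j : Fin (m + 1), ‖A i j‖ :=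
    lt_of_lt_of_le (abs_pos.mpr hM.ne) (le_sup2 (fun i j => ‖A i j‖) 0 0)
  unfold growth
  rw [le_div_iff₀ hD0]
  refine (mul_le_mul_of_nonneg_left hD hg).trans (hM.last.trans ?_)
  have hl := hit m (Fin.last m) (Fin.last m) le_rfl le_rfl
  have hl' : |gs M m m m| =
      (if (Fin.last m).1 ≤ (Fin.last m).1 ∧ (Fin.last m).1 ≤ (Fin.last m).1 then
        ‖geIter A (Fin.last m).1 (Fin.last m) (Fin.last m)‖ else 0) := by
    rw [if_pos ⟨le_rfl, le_rfl⟩, Real.norm_eq_abs]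
    exact congrArg _ hl.symm
  rw [hl']
  refine (le_sup2 (fun i j : Fin (m + 1) =>
    if (Fin.last m).1 ≤ i.1 ∧ (Fin.last m).1 ≤ j.1 then
      ‖geIter A (Fin.last m).1 i j‖ else 0) (Fin.last m) (Fin.last m)).trans ?_
  exact le_ciSup (f := fun k : Fin (m + 1) => ⨆ i : Fin (m + 1), ⨆ j : Fin (m + 1),
    if k.1 ≤ i.1 ∧ k.1 ≤ j.1 then ‖geIter A k.1 i j‖ else 0)
    (Set.finite_range _).bddAbove (Fin.last m)

/-- An integer matrix of order 11. -/
def mat11 : List (List ℤ) :=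
  [[10000000, -9999338, 9996421, -2145871, -9999768, 3785205, 2561732, -5714353, -9995194,
    9999120, 9989263],
   [9998965, 9999268, -9999467, -5046577, -9999583, 9999819, -9999778, -3013166, 9999540,
    -9995690, 9999255],
   [4019826, 9999891, 9999834, 5047402, -9999789, -940743, -5686428, -5887379, -9999891,
    -9999835, -9999789],
   [9999675, -9653457, -9999758, 9999796, 9996960, 9998772, -9999155, 9999859, -9999832,
    -1577611, 9998098],
   [9998568, 9359640, 9999730, -9999741, 173870, -9999840, 9999491, 9999873, -209310, -9999552,
    9999703],
   [-9998944, 9999712, 8011612, -9999719, 6766928, 9999804, -9999304, 9999815, -9999764,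
    9998935, -5802022],
   [-8922911, 7277026, -5646750, 9995306, 9999702, 9999731, 9999658, -9999776, -9998505,
    -9999496, 9943733],
   [9999225, 9995233, 5642708, 9999413, -8579590, 9999771, 9999820, 9999567, 9999440, 9997828,
    -9999127],
   [7342610, -9999554, 9999873, -9999825, 9999905, 9999877, -843462, -9999884, 9999575,
    -9999820, -9998867],
   [4021110, 9999494, 9999855, 9999904, 9999834, -9999313, -9999853, -9999857, 9999900,
    9999843, 9999808],
   [-9998228, -9998247, 9999888, 9999836, -9999091, 9999312, -9999517, 9999850, 9999785,
    -9999749, 9999730]]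

theorem hasG_11 : HasG 11 (1.0045 * 11) := by
  have h := hasG_of_check 11 mat11 10000000 110495 10000 (by norm_num)
    (by decide +kernel) (by decide +kernel) (by decide +kernel)
  exact h.mono (by norm_num)

/-- An integer matrix of order 12. -/
def mat12 : List (List ℤ) :=
  [[300, 299, -135, -284, -143, -292, 286, 267, 286, -210, 26, -290],
   [-299, 296, -299, -293, -288, 296, 290, 262, -250, -292, -265, 295],
   [-267, 299, 299, -27, -292, 298, -88, -284, -286, -297, 297, -280],
   [189, 294, -293, 298, 282, 297, -269, 287, 298, -296, -297, -295],
   [-260, 192, 281, -241, 284, -298, -296, -298, 292, -298, -297, 297],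
   [280, 285, 211, -297, 276, 291, 289, -296, -293, 297, -298, -297],
   [-294, -185, 274, 299, 119, -298, 298, 216, -298, -287, -299, -298],
   [284, -187, 290, -228, 297, -107, -281, 298, -297, -296, 298, 288],
   [-261, 295, 296, 256, 297, 298, 296, 298, 298, 296, 299, 298],
   [-291, 294, -298, -226, 297, -298, -296, 294, -299, 298, 222, -297],
   [-285, -298, 19, -298, 298, 299, 297, -289, 298, -297, 298, -101],
   [292, 140, -252, 296, 298, -128, 298, -295, -293, -299, 298, 297]]

theorem hasG_12 : HasG 12 (1.0045 * 12) := by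
  have h := hasG_of_check 12 mat12 300 120540 10000 (by norm_num)
    (by decide +kernel) (by decide +kernel) (by decide +kernel)
  exact h.mono (by norm_num)

/-- An integer matrix of order 13. -/
def mat13 : List (List ℤ) :=
  [[200, -199, 198, 157, -176, -176, 39, -193, 187, -180, 183, 156, 193],
   [199, 199, 172, -172, -159, 51, -197, 88, 198, 175, 15, -197, 197],
   [-199, 78, 199, 126, -130, -179, 198, 94, 195, 196, 190, -197, -198],
   [110, 197, -191, 198, -177, 199, 199, 197, -193, -197, 197, -196, 198],
   [3, 60, 194, 199, 199, 151, -199, 199, 191, -181, 198, 194, -178],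
   [-95, -80, 167, -131, -199, 197, -199, -199, -197, -198, 193, -198, -199],
   [-155, -166, 196, -197, 199, 174, 199, 198, 198, -199, -194, -198, 198],
   [181, -179, -196, 196, -157, -199, -199, 198, 192, -199, -198, -199, -197],
   [-182, 193, -69, 193, -198, 197, 192, -195, 197, -195, -198, 176, -190],
   [-181, -190, -199, 197, 198, 198, -196, -199, 199, 197, 198, -197, 197],
   [181, 193, -189, -198, 198, -133, 161, -199, 198, -198, 197, -198, -198],
   [-196, 99, -199, -189, -126, -199, -199, 198, 193, -197, 196, 185, 196],
   [-176, 198, 171, 150, 197, -199, -198, -195, -196, -198, -195, -198, 187]]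

theorem hasG_13 : HasG 13 (1.0045 * 13) := by
  have h := hasG_of_check 13 mat13 200 130585 10000 (by norm_num)
    (by decide +kernel) (by decide +kernel) (by decide +kernel)
  exact h.mono (by norm_num)

/-- An integer matrix of order 14. -/
def mat14 : List (List ℤ) :=
  [[500, 498, 405, -328, 275, -411, 483, -294, -442, 456, 490, -119, -370, 480],
   [-495, 499, -498, -418, -388, 483, 481, 490, 467, -466, 215, 479, -492, -482],
   [-497, 447, 498, 489, 488, 486, -480, 473, 497, -492, 179, -444, -493, 495],
   [406, 217, -290, 493, 418, -290, -368, 497, -462, 497, 478, -439, -477, -493],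
   [-168, -474, -467, -479, 496, 471, 492, -86, 495, -176, 496, -491, 496, -490],
   [433, -490, 494, 401, -463, 433, 494, 498, 484, 495, -348, 484, 493, 492],
   [-485, -130, -458, 459, 395, -497, -336, 497, -488, -491, 497, 495, 497, 492],
   [446, 481, 493, -495, -495, -498, -495, 495, 496, -486, 497, -443, 496, -428],
   [381, -449, -492, 496, -495, -497, 481, -497, 497, -482, 494, -491, -494, 467],
   [-484, 444, -484, -483, -152, -496, 495, 496, 482, 488, -497, -496, 435, 469],
   [-451, -495, -375, -492, -497, 491, -494, 494, -494, 492, 493, -485, -491, 496],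
   [-329, 482, -484, -228, -265, 450, -496, -495, 496, 496, 496, 496, 484, 447],
   [493, 490, -494, -47, -483, 497, 451, 468, -497, -495, -471, -472, 491, 496],
   [487, -465, -493, -496, 496, -466, -493, 488, 493, -485, -494, 489, -493, 495]]

theorem hasG_14 : HasG 14 (1.0045 * 14) := by
  have h := hasG_of_check 14 mat14 500 140630 10000 (by norm_num)
    (by decide +kernel) (by decide +kernel) (by decide +kernel)
  exact h.mono (by norm_num)

/-- An integer matrix of order 15. -/
def mat15 : List (List ℤ) :=
  [[1500, -1497, 1211, -1190, -176, -498, -1469, 1462, -1471, 1439, 1481, 1468, 1452, 684, 635],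
   [1497, 1471, -1498, -549, 1325, 1360, -1489, -740, -1458, -1450, -945, -1354, 1495, -1482,
    -1494],
   [981, 1499, 1499, 987, -1225, 949, 1066, -1445, -87, 1491, 1442, -1496, 1491, -1496, 1495],
   [1303, -1490, -903, 1496, -1444, 735, -981, 1497, 1493, -1492, 1451, -1497, 1496, 1492,
    -799],
   [118, -1422, 1368, 1444, 1418, 1492, 416, 1493, 1485, 1495, 1482, -464, -1491, -1493, -1495],
   [-1142, 294, -1094, -1428, -1487, 1368, 1466, -1496, 1492, 1494, -810, 1494, 1494, 1489,
    -1497],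
   [1365, -724, -322, -1205, 730, -693, 1493, 1497, 1491, -1463, -1496, 1487, 1495, -1495,
    1494],
   [-586, 1401, -888, -1494, -1426, 1496, -1490, 1019, 1491, -1495, 1494, 1489, -1494, -1490,
    1495],
   [1476, -1470, 1497, -1491, -1493, -1494, -1495, -1496, 1494, -1452, -1488, -1367, -1486,
    -1474, -1494],
   [1470, 1474, -1489, -1208, 1452, 849, -1484, 1495, 1489, 1496, -1494, -1489, -1491, 1486,
    1463],
   [1471, 549, -1496, 740, 1493, -1493, 10, -1498, 1478, -1371, 1498, 1495, -1485, 1486, -1492],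
   [-205, -476, 1495, 1493, 1494, 1477, -1496, -1496, 1496, -1489, -1482, 1495, 1492, 1479,
    1487],
   [-1441, 1436, 1487, -1209, 1491, -1491, 1483, 1495, 1492, -1494, 1494, -1496, 1494, 1492,
    -1490],
   [1474, 1447, 1488, 1488, -1489, 1489, 1488, 1286, -1486, -1493, -1470, 1495, -1472, 1495,
    -1495],
   [1374, -1493, 406, -1496, 1493, 1495, 1495, -1495, -1492, -1493, 1496, -1486, -1493, 1494,
    1491]]

theorem hasG_15 : HasG 15 (1.0045 * 16) := by
  have h := hasG_of_check 15 mat15 1500 160720 10000 (by norm_num)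
    (by decide +kernel) (by decide +kernel) (by decide +kernel)
  exact h.mono (by norm_num)

/-- An integer matrix of order 16. -/
def mat16 : List (List ℤ) :=
  [[300, 299, -56, -206, 284, -224, 282, 279, -178, 263, 181, -26, 288, 268, -177, 291],
   [-298, 299, 299, -287, 76, 254, -264, -16, 271, -283, -293, 293, 254, -263, -286, 292],
   [297, -294, 299, -278, -174, -237, -199, 186, 295, 297, 298, 293, 294, -292, 292, -297],
   [129, 281, 296, 298, -295, -137, 280, 135, -296, -217, 295, 297, -254, -263, 204, 296],
   [136, -272, 281, 294, 296, 271, -220, 271, 295, -295, 296, 292, -287, 293, -291, -287],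
   [280, 286, -107, -293, -191, 277, -295, -284, 287, -296, 296, -297, 239, 291, 295, 294],
   [5, -66, 20, -286, -289, 294, 265, 171, -297, -295, 295, -292, 296, -294, -296, -296],
   [-97, 218, -298, 84, -294, -47, -92, 298, 298, 284, 284, -291, -296, -297, -292, 295],
   [273, 290, 139, -292, -296, 142, 298, -296, 298, 293, -293, 294, -291, 293, -296, -294],
   [178, 297, 209, -288, 297, 298, -296, 298, -296, 297, -295, -294, -291, -294, 298, -295],
   [-154, -294, 267, -295, 293, 293, 77, -295, -86, 294, 296, -277, -296, -294, -273, 296],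
   [-296, -114, -250, -293, -294, 295, -273, 179, -294, 294, 295, 297, -278, 296, 289, 85],
   [292, -289, -285, 298, -270, 298, -293, -291, -296, 297, -291, 292, 297, -290, -285, 296],
   [-198, -282, 293, 296, -295, 297, 297, 298, 297, 291, -297, -297, 295, 275, 297, 294],
   [207, -293, -297, -296, 282, 92, 297, 296, 296, -293, -296, 295, -297, -284, 294, 292],
   [287, -296, 292, -296, -296, -297, -295, 295, -295, -296, -298, -295, -296, 293, -294, 297]]

theorem hasG_16 : HasG 16 (1.0045 * 17) := by
  have h := hasG_of_check 16 mat16 300 170765 10000 (by norm_num)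
    (by decide +kernel) (by decide +kernel) (by decide +kernel)
  exact h.mono (by norm_num)

/-- An integer matrix of order 17. -/
def mat17 : List (List ℤ) :=
  [[1500, 1496, 1396, 1298, 1417, 941, -1452, -771, 415, -369, -1420, -1333, -1311, -1365,
    -1247, -1466, -297],
   [-1487, 1496, -1494, 1453, -1405, -1132, -420, -1165, -1444, 1485, 850, 1427, -1431, -1455,
    1434, -888, 1468],
   [-1495, 1042, 1496, -1087, 1245, 854, 128, -1383, -1441, -1448, -1472, -1452, -50, -1355,
    1483, 1476, 1473],
   [-836, -1105, 1303, 1463, -1454, 1441, 337, 917, -1447, -1481, 1475, -1469, -1455, 1485,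
    -1456, -1457, 1484],
   [-591, -1099, -1475, 1069, 1465, 1015, 1456, -524, -1472, -1487, -1478, 1470, -1214, 1475,
    1485, -1489, -1481],
   [-474, 1463, -1465, -949, -1480, 1476, 1483, 1422, -1399, 1478, -1480, -1472, -1443, -536,
    -1457, 1448, -1457],
   [690, 1390, 1477, 1450, -962, -1476, 1476, -1437, -1462, -1483, 1478, 1481, -1462, -1480,
    -1478, 1478, -1483],
   [-1368, 572, 308, 1422, 1351, -664, 1249, 1457, -1178, -934, 1481, -1477, 1462, -1474, 1473,
    -1454, -1484],
   [-1443, 408, -247, 1369, -1411, 1205, 1472, -652, 1467, -1431, -1476, 1479, 1475, -1460,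
    -1483, -1437, 1467],
   [64, -1471, 1475, -1469, -1469, 1477, 1470, -1471, 1472, 1469, 1468, -1431, -1464, -1478,
    1480, -1462, -1479],
   [-80, 1469, -1475, 1468, -1476, 1475, -1487, -1460, 1467, -1482, 1477, -1474, 560, 1470,
    1482, 1476, -1481],
   [-1427, 1431, 1303, -1475, 1481, 1469, -1409, -1476, -1467, 1474, 1482, 1473, 1461, 1467,
    -1483, -1461, -1446],
   [1413, 1475, 1389, 876, -1459, -1456, 1456, -1476, -1466, 1470, -1477, -1476, 1481, 1486,
    1422, -1476, 1453],
   [398, 1448, 1476, 1484, 1473, 1481, 1480, 1472, 1483, 1481, 1440, 1458, -1470, 1452, 1478,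
    1480, 1465],
   [55, -1469, 1482, 1481, -1483, 1482, -1477, 1472, -1472, 1481, -1481, 1466, 1474, -1468,
    1466, 1479, -1475],
   [-1453, -1273, 385, 1470, 189, -1484, -369, -1468, 1470, 1466, -1465, -1472, -1459, 1477,
    -1456, 1478, -1441],
   [488, -1463, -1444, 1480, 1488, 1480, 1482, -1482, -1442, 1489, 1482, -1432, 1457, -1436,
    -1485, 1484, 1472]]

theorem hasG_17 : HasG 17 (1.0045 * 18) := by
  have h := hasG_of_check 17 mat17 1500 180810 10000 (by norm_num)
    (by decide +kernel) (by decide +kernel) (by decide +kernel)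
  exact h.mono (by norm_num)

/-- An integer matrix of order 18. -/
def mat18 : List (List ℤ) :=
  [[5000, 4996, -4980, -2752, -2710, 4985, -4826, 1091, -2735, 4957, -4946, -4980, 4841, -4269,
    -1431, 3711, -4887, 4984],
   [-4994, 4997, 4980, -4962, -4796, 1917, 3792, -1311, -248, 4974, -4942, 2522, -4993, -4955,
    -4980, 4980, 4920, -4989],
   [4994, 959, 4995, 4990, -3544, -1437, -1775, -4291, -2113, 2706, -4673, 4291, -4995, 4941,
    -4993, -3689, -4990, 4993],
   [-940, 4958, -4988, 4991, 4168, 4444, -4992, 4981, 694, 4985, 2899, 4993, 4971, -4986,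
    -4935, -4985, -2135, -4993],
   [3180, 4975, 2880, -3530, 4992, -4088, -839, 4969, 2680, 2356, 3262, -4987, -4954, -3930,
    -4993, -4984, 4995, 4995],
   [2679, -4989, 4353, 2862, 3306, 4981, 4980, 4994, -3078, 2634, -4996, -4989, -4681, 4932,
    4968, -4995, 4965, -4988],
   [4497, 4981, -3888, 4993, 4981, -4986, 4989, 3728, 4257, -4955, -4990, 4983, -4987, -4996,
    4995, 3671, -4984, 4982],
   [-1076, -290, -2293, 3065, -4995, -4991, -4988, 4995, -4974, 4991, 4981, 4991, 498, 4973,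
    4993, 4881, 4986, 4978],
   [4972, -4907, 4347, 4926, -4900, 4982, -2882, 3520, 4993, -4874, -4970, 4983, 4989, 398,
    -4974, 3225, 4991, 4976],
   [-4870, -3667, -971, -3310, -3302, -4992, 233, -4994, 4994, 4994, -4995, 4987, 4994, -4991,
    4995, -4995, 4994, 4987],
   [3772, 3000, -4994, 4558, 300, -4920, 4995, -3070, 4995, 4992, -2923, -4988, 4986, 4996,
    -4995, 4983, 3995, -4924],
   [4968, -1831, 3716, -4991, -4990, -4915, 4992, 4989, -4992, 2075, 4992, 4990, 4976, -4966,
    -3450, -4963, -4989, -3008],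
   [-4987, -4987, 4989, 4994, 4992, -4959, 4973, 4959, -4972, 4982, -4837, -4981, 4973, -4978,
    -4991, 4992, -4985, 4986],
   [3741, 3067, 4976, -4992, 3388, -4993, -4992, 4986, 4995, 4990, -4989, 4978, 4982, 4993,
    4986, 4981, -4992, -4993],
   [4841, 4983, 4989, 4975, -4979, -4990, -4989, -4984, -4993, -4992, -4993, -4985, 4995,
    -4977, 3015, -4991, 4992, -4992],
   [3567, -2024, 4949, 4992, -4979, -2288, -4989, -4988, 4986, 4994, 4995, -4986, -4992, -4981,
    4990, 4992, -4990, -4988],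
   [4960, 2914, 4990, 2614, 4976, 4987, 4969, -4993, -4585, 4993, 4978, 4993, 4992, -4989,
    4996, 2375, 4986, 4984],
   [-4946, 4987, 4992, -408, -4990, 4990, 4994, 4988, 4991, 1545, 4978, -4790, 4990, 4986,
    4982, -4983, -4987, 4991]]

theorem hasG_18 : HasG 18 (1.0045 * 20) := by
  have h := hasG_of_check 18 mat18 5000 200900 10000 (by norm_num)
    (by decide +kernel) (by decide +kernel) (by decide +kernel)
  exact h.mono (by norm_num)

/-- An integer matrix of order 20. -/
def mat20 : List (List ℤ) :=
  [[100000, -99953, 99940, -84732, 99248, 86639, -99350, 62369, -99890, 99832, -20179, -14581,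
    17016, 98597, -99758, -94668, 20441, 99555, 99803, 99822],
   [99974, 99976, 78402, 99722, -45914, 63642, 99694, 87527, -88971, -14265, -99903, -93214,
    99909, -93946, 85242, 13712, 99945, -83517, -99851, 99875],
   [-99938, 99615, 99960, -98462, -76285, -99695, 99883, -58885, 99885, 33110, -99914, 99894,
    -99882, -97058, 46209, -10334, -82493, 99850, -99680, 99904],
   [-80634, -32113, 28416, 99962, -99946, 92012, 99899, -12006, 32662, -22639, 99964, -99934,
    88796, -85588, 98748, -99956, -99942, 99953, 99793, 99913],
   [-97894, 65695, 17966, 99729, 99964, 56671, -55597, 86443, 34478, -99944, 99860, 2337,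
    99938, 94439, -99212, 99864, -99804, 99958, -99959, 96511],
   [-30617, 21251, -99854, -99384, -25298, 89781, -99749, -99665, -99732, 46607, -99726, 99750,
    99912, -99921, -99927, -99943, -99898, -99846, -99886, -99686],
   [1415, -31997, -69403, -73636, 95322, 99118, 99722, 99801, -28614, -99827, -99960, 99849,
    99860, 99882, 99828, 99944, -99954, -99905, 99961, 99712],
   [-56881, -99352, -99724, -33011, -99934, -99541, -99865, 99896, -99955, 57564, 99867, 99945,
    97453, -99945, 82643, 99956, 99821, 99936, 99903, -92547],
   [52176, -99838, -99471, -21944, -49234, 70298, -99197, 99761, 99900, -99918, 99777, -99917,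
    -99912, -99921, -99960, 99923, 98666, -99824, 99069, 99949],
   [6689, 10934, -99679, 99933, 99948, 97702, 99951, 99936, 99902, 90856, -99867, 99936, 97246,
    -99950, -99951, -99906, 99860, 99853, 99910, -99920],
   [87982, -6293, -58379, -97594, 99938, 99953, 89069, 99808, -66537, 99923, 99936, -99947,
    -99933, -99884, 99959, 99883, -99923, 99948, -99925, -99904],
   [99713, -23383, -56219, -85893, -99941, 99951, 63989, -99914, 99848, -90308, 99959, 99968,
    -37855, 99954, 99912, -99923, 99955, 68915, -99940, 99888],
   [-99753, -99894, -99644, -99901, 99868, -99819, -8406, 99742, 99957, 99953, 99904, -99736,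
    99912, 99921, 99925, -99940, 99924, -99960, -99947, 99913],
   [-98970, 99963, -99968, 96863, 31752, 99940, -99960, -99945, -92254, 99920, -99932, -99933,
    -99886, 99915, 99958, 99879, 99917, 99928, 99843, 99919],
   [-47945, -99938, 99878, -99844, 99968, 99821, -99901, -99938, 99939, -99944, -99949, -99902,
    99904, -99951, 99929, 98407, 99920, 99929, -99847, -99929],
   [99489, -99903, -99884, 62779, -93456, -99922, 89324, -99951, 99830, 99656, -99966, -99959,
    99954, 99880, -99262, 99941, -99862, 99944, -88130, 98616],
   [-73957, -99777, -16596, 91291, 93637, 99916, 99899, -99921, -99937, 99871, 99914, 99958,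
    -99929, -99871, -99918, 99928, 99891, -99942, -68339, 99909],
   [9758, 69033, -61723, -99911, 99934, -99956, 99942, -99933, -99954, -99959, 99919, -99865,
    99780, -99951, -99956, -54369, 99840, 99016, 99894, 99903],
   [99782, 99444, 64403, 94819, 99860, -93503, -99917, -99677, 99881, 99936, 99939, 99905,
    99491, -99948, 99462, 99894, -99757, -99917, 99819, 99931],
   [99683, -98155, -99939, 99864, 99946, -99840, -99687, 99538, -98917, -99925, -99375, 99867,
    -99878, -85830, 99941, -99965, -92166, 99932, -99927, 99796]]

theorem hasG_20 : HasG 20 (1.0045 * 24) := by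
  have h := hasG_of_check 20 mat20 100000 241080 10000 (by norm_num)
    (by decide +kernel) (by decide +kernel) (by decide +kernel)
  exact h.mono (by norm_num)

/-- An integer matrix of order 24. -/
def mat24 : List (List ℤ) :=
  [[10000, 9967, 9988, 7399, 2737, -716, 9936, -3096, 4912, -4424, -9860, 8593, 9920, 8465,
    9953, 9531, -8199, -1753, -9809, -8486, 9868, 7890, 4057, 9918],
   [-9991, 9991, 9863, -3298, -9470, -5090, -5808, -8630, 185, 8603, -7311, -2097, -9967,
    -3564, -1201, -9935, -9725, 9983, 9939, 4614, -4093, 9978, -1690, 9956],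
   [-6071, -9992, 9989, 9942, 8318, 5499, -1047, -9948, -9422, -9952, 9965, 8032, -2775, 6596,
    8619, -4162, -9969, -9539, 9958, -9593, -6997, 9961, 9979, -9932],
   [-6707, 5415, -8988, 9786, 9953, -3638, -9968, 8389, 9774, -6118, 9813, 4027, 9975, 9953,
    9972, -7330, 9877, -9590, 5776, 9976, -9972, 9937, -9976, 9923],
   [-1763, 8167, 8515, -9947, 9950, 9949, 9675, 383, -9958, 9778, -5523, -9853, -9958, 9974,
    -9957, 3659, 9966, -9265, 9682, 9947, 9979, 9978, 6657, 3449],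
   [2123, 8571, -9902, 9957, -9947, 9976, -9950, 9343, 9955, -9945, 9948, -9967, 9931, -9947,
    -9943, -9965, -9930, -9763, -9282, 9756, 9978, 9890, 9973, 9940],
   [-9976, -1801, -9774, 2643, -5759, -3591, 9968, -4373, 9918, 5944, -9942, -9958, -9941,
    7790, 5374, -9944, -9889, -9975, -9980, -9943, -9917, 9825, -9967, -9931],
   [-9782, -4300, 9942, -1880, -9834, -9947, 9918, 9965, 9968, -9941, -1043, -9974, 9952, 2878,
    7113, -9834, 9521, 9853, 9980, -9971, 9962, -9910, -5244, -9928],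
   [4208, 971, 2565, -7124, 9939, 9928, -9933, -9330, 9951, -9970, -9940, 2738, -9970, 9967,
    9949, -6994, -9980, 4383, 9907, 9981, 9972, -9977, -9960, -9948],
   [-2432, -7038, 9953, 7684, -8966, -1430, -9959, 4246, 3974, 9979, -9957, 9873, 9985, -9967,
    -9895, 9950, -9949, -9970, 9955, 9936, 9907, 9957, -9973, -9983],
   [8952, -3996, 9600, -8528, 9914, 9973, 8248, -9982, 6391, -1892, 9935, -9810, 9970, -9964,
    7810, -9957, 9981, 9975, -9978, 7463, -1541, 9986, -9974, -9961],
   [-9547, 9950, 3237, -7238, 1, 9950, 9971, 9968, 9840, -9894, 9902, 5109, 9948, 9967, -9930,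
    9966, -9976, 9981, -5608, 9980, -9982, 8318, 9947, -9971],
   [3607, 9980, -180, -9964, 2643, 9979, 9911, -8774, -9955, -9863, -9950, -9918, 9982, -9976,
    -9870, 6443, -9953, -9980, 9980, -9980, -9976, -9971, -9976, 9925],
   [9389, 9631, -9927, -5737, -9964, 3772, -9955, -9925, 9973, 9949, -9899, -9979, 9923, 9303,
    9977, 9981, 9927, 9581, 9965, -9804, -9959, 9932, 9981, -9959],
   [-4960, 9484, 9938, -1080, -9926, 9954, 7138, 3515, -9901, 8868, -9982, 9918, -2089, -9941,
    9979, -9957, 9844, -9975, -9963, 9982, -9975, -9974, 9972, -9855],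
   [-9694, 9968, -851, 9967, 2363, 9923, -9958, 7067, -9905, -8351, 9952, 5048, -9978, -9979,
    9904, 9967, 9971, 9253, -5059, -9982, 9974, 9958, -9978, -9925],
   [9825, -9947, -6015, 7192, -9957, 9984, 9890, 9975, 9865, -9968, -9949, 9980, -9974, 9945,
    -9963, -9957, 9965, 9967, 6845, -9960, -9909, 9969, -9967, 9959],
   [-9861, -9982, -9955, -9971, 9964, 9968, -9874, 9970, -9916, 9934, -9972, 9944, 9968, -9898,
    9530, -9967, -5414, 9969, -8883, -9960, 9938, 9969, 9937, 9959],
   [2785, -6408, 5116, -656, 9977, 8672, 9948, 9967, 9987, 9982, 9977, -9971, -9972, -9980,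
    9980, 9976, -9977, -9960, 9981, -9961, -9223, -9975, 9968, 9971],
   [9855, -2906, -9874, 9981, 9968, -9963, 9939, 9968, -9970, -9946, -9981, -9983, -4860,
    -9923, 9961, 9944, -9948, 9972, 9905, 9983, -9963, 9938, 9966, -9963],
   [-9836, -9319, -9962, -9948, -9855, -9885, 9713, -9977, 9957, -9940, -8080, 9919, -9898,
    -9975, 9961, 9963, 9953, -9942, 9920, 9946, 9954, 9832, 9953, 9630],
   [4085, 9655, 9906, -9633, 9954, -9967, -9960, 9972, 9973, -9959, -9955, 9957, -9966, -9971,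
    -9960, -9948, 9953, -9157, -9920, -9978, -9827, 9950, 9961, -9890],
   [1878, 9820, -9972, 9975, 9978, -1324, 9967, -9970, 9978, 9968, -5709, 9976, 9847, -9953,
    -9980, -9966, 9922, 9963, 9974, -9961, 9962, -6318, 9939, -9896],
   [-9655, -9493, 9952, 9986, 9314, 9976, -9887, -9920, 9937, -9917, -9978, -9973, -933, 9214,
    -9894, 9908, 9977, 9950, -9714, 9854, -9978, -9968, 9968, 9910]]

theorem hasG_24 : HasG 24 (1.0045 * 30) := by
  have h := hasG_of_check 24 mat24 10000 301350 10000 (by norm_num)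
    (by decide +kernel) (by decide +kernel) (by decide +kernel)
  exact h.mono (by norm_num)

/-! ### Assembly -/

theorem hasG_ge_fifteen (n : ℕ) (hn : 15 ≤ n) : HasG n (1.0045 * ((n : ℝ) + 1)) := by
  induction n using Nat.strong_induction_on with
  | _ n ih =>
    by_cases h30 : 30 ≤ n
    · obtain ⟨q, hq | hq⟩ : ∃ q, n = 2 * q ∨ n = 2 * q + 1 := ⟨n / 2, by omega⟩
      · subst hq
        refine (ih q (by omega) (by omega)).double.mono ?_
        push_cast
        linarith
      · subst hq
        refine (ih q (by omega) (by omega)).double.succ.mono (le_of_eq ?_)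
        push_cast
        ring
    · push Not at h30
      interval_cases n
      · exact hasG_15.mono (by norm_num)
      · exact hasG_16.mono (by norm_num)
      · exact hasG_17.mono (by norm_num)
      · exact hasG_18.mono (by norm_num)
      · exact hasG_18.succ.mono (by norm_num)
      · exact hasG_20.mono (by norm_num)
      · exact hasG_20.succ.mono (by norm_num)
      · exact hasG_20.succ.succ.mono (by norm_num)
      · exact hasG_20.succ.succ.succ.mono (by norm_num)
      · exact hasG_24.mono (by norm_num)
      · exact hasG_24.succ.mono (by norm_num)
      · exact hasG_24.succ.succ.mono (by norm_num)
      · exact hasG_24.succ.succ.succ.mono (by norm_num)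
      · exact hasG_24.succ.succ.succ.succ.mono (by norm_num)
      · exact hasG_24.succ.succ.succ.succ.succ.mono (by norm_num)

/-- `g[CP_n(ℝ)] ≥ 1.0045 · n` for every `n > 10`. -/
theorem growth_factor_lower_bound (n : ℕ) (hn : 10 < n) :
    1.0045 * (n : ℝ) ≤ gCP ℝ n := by
  refine HasG.le_gCP (by positivity) ?_
  by_cases h15 : 15 ≤ n
  · exact (hasG_ge_fifteen n h15).mono (by linarith)
  · push Not at h15
    interval_cases n
    · exact hasG_11.mono (by norm_num)
    · exact hasG_12.mono (by norm_num)
    · exact hasG_13.mono (by norm_num)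
    · exact hasG_14.mono (by norm_num)
end

section
/- Let S ⊂ ℝ be a compact set containing at least two points, so that diam(S) := max_{s,s' ∈ S} |s − s'| > 0 and max_{s ∈ S} |s| > 0 are attained. Then for every n ≥ 1 and every m > 4n(3n+1), g[CP_m(S)] ≥ (diam(S) / (2 max_{s ∈ S} |s|)) · g[CP_n(ℝ)]. -/
open scoped BigOperators

/-- One step of elimination. -/
noncomputable def sch {n : ℕ} (A : Matrix (Fin (n + 1)) (Fin (n + 1)) ℝ) :
    Matrix (Fin n) (Fin n) ℝ :=
  fun i j => A i.succ j.succ - A i.succ 0 * A 0 j.succ / A 0 0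

/-- Recursive form of complete pivoting. -/
def RCP : (n : ℕ) → Matrix (Fin n) (Fin n) ℝ → Prop
  | 0, _ => True
  | n + 1, A => A 0 0 ≠ 0 ∧ (∀ i j, |A i j| ≤ |A 0 0|) ∧ RCP n (sch A)

/-- Some pivot has absolute value at least `γ`. -/
def RP : (n : ℕ) → Matrix (Fin n) (Fin n) ℝ → ℝ → Prop
  | 0, _, _ => False
  | n + 1, A, γ => γ ≤ |A 0 0| ∨ RP n (sch A) γ

/-- Absolute value of the last pivot. -/
noncomputable def lastp : (n : ℕ) → Matrix (Fin (n + 1)) (Fin (n + 1)) ℝ → ℝ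
  | 0, A => |A 0 0|
  | n + 1, A => lastp n (sch A)

theorem geIter_sch {n : ℕ} (A : Matrix (Fin (n + 1)) (Fin (n + 1)) ℝ) (k : ℕ) :
    ∀ i j : Fin n, geIter A (k + 1) i.succ j.succ = geIter (sch A) k i j := by
  induction k with
  | zero =>
    intro i j
    simp [geIter, sch]
  | succ k ih =>
    intro i j
    rw [geIter.eq_2 A (k + 1), geIter.eq_2 (sch A) k]
    beta_reduce
    by_cases h : k < n ∧ k + 1 ≤ i.1 ∧ k + 1 ≤ j.1
    · have h' : k + 1 < n + 1 ∧ k + 1 + 1 ≤ (i.succ).1 ∧ k + 1 + 1 ≤ (j.succ).1 := by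
        simp only [Fin.val_succ]; omega
      rw [dif_pos h, dif_pos h']
      have e : (⟨k + 1, h'.1⟩ : Fin (n + 1)) = Fin.succ ⟨k, h.1⟩ := rfl
      rw [e, ih, ih, ih, ih]
    · have h' : ¬ (k + 1 < n + 1 ∧ k + 1 + 1 ≤ (i.succ).1 ∧ k + 1 + 1 ≤ (j.succ).1) := by
        simp only [Fin.val_succ]; omega
      rw [dif_neg h, dif_neg h', ih]

theorem pivotNorm_sch {n : ℕ} (A : Matrix (Fin (n + 1)) (Fin (n + 1)) ℝ) (k : ℕ) :
    pivotNorm A (k + 1) = pivotNorm (sch A) k := by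
  unfold pivotNorm
  by_cases h : k < n
  · have h' : k + 1 < n + 1 := by omega
    rw [dif_pos h, dif_pos h']
    have e : (⟨k + 1, h'⟩ : Fin (n + 1)) = Fin.succ ⟨k, h⟩ := rfl
    rw [e, geIter_sch]
  · have h' : ¬ (k + 1 < n + 1) := by omega
    rw [dif_neg h, dif_neg h']

theorem pivotNorm_zero {n : ℕ} (A : Matrix (Fin (n + 1)) (Fin (n + 1)) ℝ) :
    pivotNorm A 0 = |A 0 0| := by
  simp [pivotNorm, geIter]

theorem det_sch {n : ℕ} (A : Matrix (Fin (n + 1)) (Fin (n + 1)) ℝ) (h : A 0 0 ≠ 0) :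
    A.det = A 0 0 * (sch A).det := by
  have key := Matrix.det_eq_of_forall_row_eq_smul_add_const (A := A)
    (B := Matrix.of fun i j => Fin.cases (motive := fun _ => ℝ) (A 0 j)
      (fun i' => A i'.succ j - A i'.succ 0 / A 0 0 * A 0 j) i)
    (fun i => Fin.cases (motive := fun _ => ℝ) 0 (fun i' => A i'.succ 0 / A 0 0) i) 0 rfl
    (by
      intro i j
      refine Fin.cases ?_ (fun i' => ?_) i
      · simp
      · simp)
  rw [key, Matrix.det_succ_column_zero, Fin.sum_univ_succ, Finset.sum_eq_zero]
  · simp only [Fin.val_zero, pow_zero, one_mul, add_zero, Matrix.of_apply, Fin.cases_zero]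
    congr 2
    ext i j
    simp only [Matrix.submatrix_apply, Matrix.of_apply, sch, Fin.zero_succAbove, Fin.cases_succ]
    ring
  · intro i _
    simp [h]

theorem isCP_iff : ∀ (n : ℕ) (A : Matrix (Fin n) (Fin n) ℝ), IsCP A ↔ RCP n A := by
  intro n
  induction n with
  | zero =>
    intro A
    simp only [RCP, iff_true]
    refine ⟨by simp, fun k hk => by omega, fun k i => i.elim0⟩
  | succ n ih =>
    intro A
    constructor
    · rintro ⟨h1, h2, h3⟩
      have h0 : A 0 0 ≠ 0 := by
        rcases Nat.eq_zero_or_pos n with hn | hn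
        · subst hn
          simpa [Matrix.det_fin_one] using h1
        · have := h2 0 (by omega)
          rw [pivotNorm_zero] at this
          simpa using this
      refine ⟨h0, fun i j => ?_, (ih _).1 ⟨?_, ?_, ?_⟩⟩
      · have := h3 0 i j (Nat.zero_le _) (Nat.zero_le _)
        rwa [pivotNorm_zero] at this
      · rw [det_sch A h0] at h1
        exact right_ne_zero_of_mul h1
      · intro k hk
        rw [← pivotNorm_sch]
        exact h2 (k + 1) (by omega)
      · intro k i j hi hj
        rw [← pivotNorm_sch, ← geIter_sch]
        exact h3 (k + 1) _ _ (by simpa using hi) (by simpa using hj)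
    · rintro ⟨h0, h1, h2⟩
      obtain ⟨a, b, c⟩ := (ih _).2 h2
      refine ⟨?_, ?_, ?_⟩
      · rw [det_sch A h0]
        exact mul_ne_zero h0 a
      · intro k hk
        cases k with
        | zero => rw [pivotNorm_zero]; simpa using h0
        | succ k => rw [pivotNorm_sch]; exact b k (by omega)
      · intro k i j hi hj
        cases k with
        | zero => rw [pivotNorm_zero]; exact h1 i j
        | succ k =>
          rw [pivotNorm_sch]
          obtain ⟨i', rfl⟩ := Fin.exists_succ_eq.2 (show i ≠ 0 by rintro rfl; simp at hi)
          obtain ⟨j', rfl⟩ := Fin.exists_succ_eq.2 (show j ≠ 0 by rintro rfl; simp at hj)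
          rw [geIter_sch]
          exact c k i' j' (by simpa using hi) (by simpa using hj)

theorem sch_bound {n : ℕ} (A : Matrix (Fin (n + 1)) (Fin (n + 1)) ℝ) (h0 : A 0 0 ≠ 0)
    (h : ∀ i j, |A i j| ≤ |A 0 0|) (i j : Fin n) : |sch A i j| ≤ 2 * |A 0 0| := by
  have hp : 0 < |A 0 0| := abs_pos.2 h0
  have : |A i.succ 0 * A 0 j.succ / A 0 0| ≤ |A 0 0| := by
    rw [abs_div, abs_mul, div_le_iff₀ hp]
    exact mul_le_mul (h _ _) (h _ _) (abs_nonneg _) hp.le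
  have h2 := abs_sub (A i.succ j.succ) (A i.succ 0 * A 0 j.succ / A 0 0)
  have h3 := h i.succ j.succ
  unfold sch
  linarith

theorem lastp_le : ∀ (n : ℕ) (A : Matrix (Fin (n + 1)) (Fin (n + 1)) ℝ), RCP (n + 1) A →
    lastp n A ≤ 2 ^ n * |A 0 0| := by
  intro n
  induction n with
  | zero => intro A _; simp [lastp]
  | succ n ih =>
    intro A hA
    have h1 := ih _ hA.2.2
    have h2 := sch_bound A hA.1 hA.2.1 0 0
    calc lastp (n + 1) A = lastp n (sch A) := rfl
      _ ≤ 2 ^ n * |sch A 0 0| := h1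
      _ ≤ 2 ^ n * (2 * |A 0 0|) := by gcongr
      _ = _ := by ring

theorem geIter_le : ∀ (n : ℕ) (A : Matrix (Fin n) (Fin n) ℝ), RCP n A → ∀ (k : ℕ) (i j : Fin n)
    (h : k + 1 ≤ n), k ≤ i.1 → k ≤ j.1 →
    |geIter A k i j| ≤ lastp k (A.submatrix (Fin.castLE h) (Fin.castLE h)) := by
  intro n
  induction n with
  | zero => intro A _ k i; exact i.elim0
  | succ n ih =>
    intro A hA k i j h hi hj
    cases k with
    | zero => exact hA.2.1 i j
    | succ k =>
      obtain ⟨i', rfl⟩ := Fin.exists_succ_eq.2 (show i ≠ 0 by rintro rfl; simp at hi)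
      obtain ⟨j', rfl⟩ := Fin.exists_succ_eq.2 (show j ≠ 0 by rintro rfl; simp at hj)
      rw [geIter_sch]
      exact ih _ hA.2.2 k i' j' (by omega) (by simpa using hi) (by simpa using hj)

theorem RCP_sub : ∀ (l n : ℕ) (h : l ≤ n) (A : Matrix (Fin n) (Fin n) ℝ), RCP n A →
    RCP l (A.submatrix (Fin.castLE h) (Fin.castLE h)) := by
  intro l
  induction l with
  | zero => intro n h A _; trivial
  | succ l ih =>
    intro n h A hA
    cases n with
    | zero => omega
    | succ n =>
      refine ⟨hA.1, fun i j => hA.2.1 _ _, ?_⟩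
      exact ih n (by omega) _ hA.2.2

theorem RP_lastp : ∀ (n : ℕ) (A : Matrix (Fin (n + 1)) (Fin (n + 1)) ℝ) (γ : ℝ),
    γ ≤ lastp n A → RP (n + 1) A γ := by
  intro n
  induction n with
  | zero => intro A γ h; exact Or.inl h
  | succ n ih => intro A γ h; exact Or.inr (ih _ _ h)

theorem RP_geIter : ∀ (n : ℕ) (A : Matrix (Fin n) (Fin n) ℝ) (γ : ℝ), RP n A γ →
    ∃ k : Fin n, γ ≤ |geIter A k.1 k k| := by
  intro n
  induction n with
  | zero => intro A γ h; exact h.elim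
  | succ n ih =>
    intro A γ h
    rcases h with h | h
    · exact ⟨0, h⟩
    · obtain ⟨k, hk⟩ := ih _ _ h
      exact ⟨k.succ, by rw [Fin.val_succ, geIter_sch]; exact hk⟩

theorem sch_smul {n : ℕ} (A : Matrix (Fin (n + 1)) (Fin (n + 1)) ℝ) (c : ℝ) (hc : c ≠ 0) :
    sch (c • A) = c • sch A := by
  ext i j
  simp only [sch, Matrix.smul_apply, smul_eq_mul]
  by_cases h : A 0 0 = 0
  · simp [h]
  · field_simp

theorem RCP_smul : ∀ (n : ℕ) (A : Matrix (Fin n) (Fin n) ℝ) (c : ℝ), c ≠ 0 → RCP n A →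
    RCP n (c • A) := by
  intro n
  induction n with
  | zero => intros; trivial
  | succ n ih =>
    intro A c hc hA
    refine ⟨mul_ne_zero hc hA.1, fun i j => ?_, ?_⟩
    · simp only [Matrix.smul_apply, smul_eq_mul, abs_mul]
      exact mul_le_mul_of_nonneg_left (hA.2.1 i j) (abs_nonneg c)
    · rw [sch_smul A c hc]
      exact ih _ c hc hA.2.2

theorem RP_smul : ∀ (n : ℕ) (A : Matrix (Fin n) (Fin n) ℝ) (c γ : ℝ), c ≠ 0 → RP n A γ →
    RP n (c • A) (|c| * γ) := by
  intro n
  induction n with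
  | zero => intro A c γ _ h; exact h
  | succ n ih =>
    intro A c γ hc hA
    rcases hA with h | h
    · left
      simp only [Matrix.smul_apply, smul_eq_mul, abs_mul]
      exact mul_le_mul_of_nonneg_left h (abs_nonneg c)
    · right
      rw [sch_smul A c hc]
      exact ih _ c γ hc h

theorem lastp_smul : ∀ (n : ℕ) (A : Matrix (Fin (n + 1)) (Fin (n + 1)) ℝ) (c : ℝ), c ≠ 0 →
    lastp n (c • A) = |c| * lastp n A := by
  intro n
  induction n with
  | zero => intro A c _; simp [lastp, abs_mul]
  | succ n ih =>
    intro A c hc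
    simp only [lastp]
    rw [sch_smul A c hc, ih _ c hc]

/-- Bordering: the inverse of an elimination step. -/
noncomputable def bord {n : ℕ} (p : ℝ) (c r : Fin n → ℝ) (N : Matrix (Fin n) (Fin n) ℝ) :
    Matrix (Fin (n + 1)) (Fin (n + 1)) ℝ :=
  fun i j => Fin.cases (motive := fun _ => ℝ)
    (Fin.cases (motive := fun _ => ℝ) p (fun j' => r j') j)
    (fun i' => Fin.cases (motive := fun _ => ℝ) (c i') (fun j' => N i' j' + c i' * r j' / p) j) i

section
variable {n : ℕ} (p : ℝ) (c r : Fin n → ℝ) (N : Matrix (Fin n) (Fin n) ℝ)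

theorem bord_zz : bord p c r N 0 0 = p := rfl
theorem bord_zs (j : Fin n) : bord p c r N 0 j.succ = r j := rfl
theorem bord_sz (i : Fin n) : bord p c r N i.succ 0 = c i := rfl
theorem bord_ss (i j : Fin n) : bord p c r N i.succ j.succ = N i j + c i * r j / p := rfl

theorem sch_bord : sch (bord p c r N) = N := by
  ext i j
  simp [sch, bord_zz, bord_zs, bord_sz, bord_ss]

theorem RCP_bord (hp : p ≠ 0) (hN : RCP n N) (h : ∀ i j, |bord p c r N i j| ≤ |p|) :
    RCP (n + 1) (bord p c r N) :=
  ⟨hp, h, by rw [sch_bord]; exact hN⟩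

theorem RP_bord (γ : ℝ) (hN : RP n N γ) : RP (n + 1) (bord p c r N) γ :=
  Or.inr (by rw [sch_bord]; exact hN)

end

/-- Level of an entry. -/
def lev : ℕ → ℝ → Prop
  | 0, x => x = 0 ∨ x = 1
  | K + 1, x => |x| ≤ 1 ∧ ∃ z : ℤ, x = z / 2 ^ K

theorem lev_abs (d : ℕ) (x : ℝ) (h : lev d x) : |x| ≤ 1 := by
  cases d with
  | zero => rcases h with rfl | rfl <;> simp
  | succ d => exact h.1

theorem lev_zero (d : ℕ) : lev d 0 := by
  cases d with
  | zero => exact Or.inl rfl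
  | succ d => exact ⟨by simp, 0, by simp⟩

theorem pert_scalar (p c r x p' c' r' x' ε : ℝ) (hp : p ≠ 0) (hp' : p' ≠ 0)
    (h1 : |p' - p| ≤ ε) (h2 : |c' - c| ≤ ε) (h3 : |r' - r| ≤ ε) (h4 : |x' - x| ≤ ε)
    (hc : |c| ≤ |p|) (hr : |r'| ≤ |p'|) :
    |(x' - c' * r' / p') - (x - c * r / p)| ≤ 4 * ε := by
  have e : (x' - c' * r' / p') - (x - c * r / p) =
      (x' - x) - (c / p) * (r' - r) + (r' / p') * ((c / p) * (p' - p) - (c' - c)) := by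
    field_simp
    ring
  have a1 : |c / p| ≤ 1 := by
    rw [abs_div]; exact div_le_one_of_le₀ hc (abs_nonneg _)
  have a2 : |r' / p'| ≤ 1 := by
    rw [abs_div]; exact div_le_one_of_le₀ hr (abs_nonneg _)
  have hε : 0 ≤ ε := (abs_nonneg _).trans h1
  have b1 : |(c / p) * (r' - r)| ≤ ε := by
    rw [abs_mul]; nlinarith [abs_nonneg (r' - r), abs_nonneg (c / p)]
  have b2 : |(c / p) * (p' - p)| ≤ ε := by
    rw [abs_mul]; nlinarith [abs_nonneg (p' - p), abs_nonneg (c / p)]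
  have b3 : |(c / p) * (p' - p) - (c' - c)| ≤ 2 * ε := by
    have := abs_sub ((c / p) * (p' - p)) (c' - c)
    linarith
  have b4 : |(r' / p') * ((c / p) * (p' - p) - (c' - c))| ≤ 2 * ε := by
    rw [abs_mul]
    nlinarith [abs_nonneg ((c / p) * (p' - p) - (c' - c)), abs_nonneg (r' / p')]
  rw [e]
  have c1 := abs_add_le ((x' - x) - (c / p) * (r' - r))
    ((r' / p') * ((c / p) * (p' - p) - (c' - c)))
  have c2 := abs_sub (x' - x) ((c / p) * (r' - r))
  linarith

theorem pert : ∀ (n : ℕ) (A A' : Matrix (Fin (n + 1)) (Fin (n + 1)) ℝ) (t θ ε : ℝ),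
    RCP (n + 1) A → 0 < θ → θ < 1 → 0 < t → 0 < ε →
    (∀ i j, |A' i j - t * θ ^ (i.1) * θ ^ (j.1) * A i j| ≤ ε) →
    2 * 4 ^ n * ε ≤ (1 - θ) * (t * (θ ^ 2) ^ n) * lastp n A / 2 ^ n →
    RCP (n + 1) A' ∧ t * (θ ^ 2) ^ n * lastp n A - 4 ^ n * ε ≤ lastp n A' := by
  intro n
  induction n with
  | zero =>
    intro A A' t θ ε hA hθ hθ1 ht hε h hc
    have h00 := h 0 0
    simp only [Fin.val_zero, pow_zero, mul_one, lastp, div_one, one_mul] at h00 hc ⊢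
    have e1 : |t * A 0 0| = t * |A 0 0| := by rw [abs_mul, abs_of_pos ht]
    have e2 := abs_sub_abs_le_abs_sub (t * A 0 0) (A' 0 0)
    rw [abs_sub_comm] at e2
    have e3 : (1 - θ) * t * |A 0 0| ≤ t * |A 0 0| := by
      have : 0 ≤ t * |A 0 0| := by positivity
      nlinarith
    refine ⟨⟨?_, ?_, trivial⟩, ?_⟩
    · rw [← abs_pos]; linarith
    · intro i j
      have hi : i = 0 := Fin.ext (Nat.lt_one_iff.1 i.2)
      have hj : j = 0 := Fin.ext (Nat.lt_one_iff.1 j.2)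
      rw [hi, hj]
    · linarith
  | succ n ih =>
    intro A A' t θ ε hA hθ hθ1 ht hε h hc
    have hX : 0 ≤ (1 - θ) * (t * (θ ^ 2) ^ (n + 1)) * lastp (n + 1) A / 2 ^ (n + 1) :=
      le_trans (by positivity) hc
    have hl := lastp_le (n + 1) A hA
    have hP : 2 * ε ≤ (1 - θ) * (t * |A 0 0|) := by
      have h1 : (1 : ℝ) ≤ 4 ^ (n + 1) := one_le_pow₀ (by norm_num)
      have h2 : (θ ^ 2) ^ (n + 1) ≤ 1 := pow_le_one₀ (by positivity) (by nlinarith)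
      have h3 : lastp (n + 1) A / 2 ^ (n + 1) ≤ |A 0 0| := by
        rw [div_le_iff₀ (by positivity)]; linarith
      have h4 : 0 < 1 - θ := by linarith
      calc 2 * ε ≤ 2 * 4 ^ (n + 1) * ε := by nlinarith
        _ ≤ _ := hc
        _ = (1 - θ) * t * (θ ^ 2) ^ (n + 1) * (lastp (n + 1) A / 2 ^ (n + 1)) := by ring
        _ ≤ (1 - θ) * t * (θ ^ 2) ^ (n + 1) * |A 0 0| := by gcongr
        _ ≤ (1 - θ) * t * 1 * |A 0 0| := by gcongr
        _ = _ := by ring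
    have h00 : |A' 0 0 - t * A 0 0| ≤ ε := by simpa using h 0 0
    have e1 : |t * A 0 0| = t * |A 0 0| := by rw [abs_mul, abs_of_pos ht]
    have e2 := abs_sub_abs_le_abs_sub (t * A 0 0) (A' 0 0)
    rw [abs_sub_comm] at e2
    have hApos : 0 < |A 0 0| := abs_pos.2 hA.1
    have htA : 0 < t * |A 0 0| := by positivity
    have hA'0 : A' 0 0 ≠ 0 := by
      rw [← abs_pos]; nlinarith
    have hoff : ∀ i j : Fin (n + 2), 1 ≤ i.1 + j.1 →
        |t * θ ^ (i.1) * θ ^ (j.1) * A i j| ≤ θ * (t * |A 0 0|) := by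
      intro i j hij
      have : θ ^ (i.1) * θ ^ (j.1) ≤ θ := by
        rw [← pow_add]
        calc θ ^ (i.1 + j.1) ≤ θ ^ 1 := pow_le_pow_of_le_one hθ.le hθ1.le hij
          _ = θ := pow_one _
      rw [abs_mul, abs_mul, abs_mul, abs_of_pos ht, abs_of_pos (pow_pos hθ _),
        abs_of_pos (pow_pos hθ _)]
      calc t * θ ^ (i.1) * θ ^ (j.1) * |A i j| = t * (θ ^ (i.1) * θ ^ (j.1)) * |A i j| := by ring
        _ ≤ t * θ * |A 0 0| := by
          exact mul_le_mul (mul_le_mul_of_nonneg_left this ht.le) (hA.2.1 i j) (abs_nonneg _)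
            (by positivity)
        _ = _ := by ring
    have hdom : ∀ i j, |A' i j| ≤ |A' 0 0| := by
      intro i j
      by_cases hij : 1 ≤ i.1 + j.1
      · have h1 := hoff i j hij
        have h2 := h i j
        have h3 := abs_sub_abs_le_abs_sub (A' i j) (t * θ ^ (i.1) * θ ^ (j.1) * A i j)
        linarith
      · have hi : i = 0 := Fin.ext (by rw [Fin.val_zero]; omega)
        have hj : j = 0 := Fin.ext (by rw [Fin.val_zero]; omega)
        rw [hi, hj]
    have key := ih (sch A) (sch A') (t * θ ^ 2) θ (4 * ε) hA.2.2 hθ hθ1 (by positivity)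
      (by positivity) ?_ ?_
    · refine ⟨⟨hA'0, hdom, key.1⟩, ?_⟩
      have := key.2
      simp only [lastp]
      calc _ = t * θ ^ 2 * (θ ^ 2) ^ n * lastp n (sch A) - 4 ^ n * (4 * ε) := by ring
        _ ≤ _ := this
    · intro i j
      have q := pert_scalar (t * A 0 0) (t * θ ^ (i.succ.1) * θ ^ 0 * A i.succ 0)
        (t * θ ^ 0 * θ ^ (j.succ.1) * A 0 j.succ)
        (t * θ ^ (i.succ.1) * θ ^ (j.succ.1) * A i.succ j.succ)
        (A' 0 0) (A' i.succ 0) (A' 0 j.succ) (A' i.succ j.succ) ε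
        (mul_ne_zero ht.ne' hA.1) hA'0 h00 (h _ _) (h _ _) (h _ _) ?_ (hdom _ _)
      · refine le_of_eq_of_le ?_ q
        congr 1
        simp only [sch, Fin.val_succ]
        have := hA.1
        have := ht.ne'
        field_simp
        ring
      · refine (hoff i.succ 0 (by simp)).trans ?_
        rw [e1]
        nlinarith
    · have e : (1 - θ) * (t * (θ ^ 2) ^ (n + 1)) * lastp (n + 1) A / 2 ^ (n + 1) * 2 =
        (1 - θ) * (t * θ ^ 2 * (θ ^ 2) ^ n) * lastp n (sch A) / 2 ^ n := by
        simp only [lastp, pow_succ _ n]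
        field_simp
      rw [← e]
      calc 2 * 4 ^ n * (4 * ε) = 2 * 4 ^ (n + 1) * ε := by ring
        _ ≤ _ := hc
        _ ≤ _ := by linarith

/-- First basis vector. -/
noncomputable def e0 {n : ℕ} : Fin (n + 1) → ℝ := fun j => if j = 0 then 1 else 0

theorem e0_z {n : ℕ} : (e0 : Fin (n + 1) → ℝ) 0 = 1 := by simp [e0]
theorem e0_s {n : ℕ} (j : Fin n) : (e0 : Fin (n + 1) → ℝ) j.succ = 0 := by simp [e0]

/-- Threefold bordering. -/
noncomputable def trip {n : ℕ} (c b : Fin n → ℝ) (N : Matrix (Fin n) (Fin n) ℝ) :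
    Matrix (Fin (n + 3)) (Fin (n + 3)) ℝ :=
  bord 1 e0 e0 (bord (-1) e0 e0 (bord 2 c b N))

theorem trip_RCP {n : ℕ} (c b : Fin n → ℝ) (N : Matrix (Fin n) (Fin n) ℝ)
    (hb : ∀ j, b j = 0 ∨ b j = 1) (hc : ∀ i, |c i| ≤ 1)
    (hx : ∀ i j, |N i j + c i * b j / 2| ≤ 1) (hN : RCP n N)
    (hM : ∀ i j, |trip c b N i j| ≤ 1) : RCP (n + 3) (trip c b N) := by
  have hb' : ∀ j, |b j| ≤ 1 := fun j => by rcases hb j with h | h <;> simp [h]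
  refine RCP_bord _ _ _ _ (by norm_num) (RCP_bord _ _ _ _ (by norm_num)
    (RCP_bord _ _ _ _ (by norm_num) hN ?_) ?_) (by rw [abs_one]; exact hM)
  · intro i j
    rw [abs_of_pos (show (0 : ℝ) < 2 by norm_num)]
    rcases Fin.eq_zero_or_eq_succ i with rfl | ⟨i, rfl⟩ <;>
      rcases Fin.eq_zero_or_eq_succ j with rfl | ⟨j, rfl⟩
    · rw [bord_zz]; norm_num
    · rw [bord_zs]; linarith [hb' j]
    · rw [bord_sz]; linarith [hc i]
    · rw [bord_ss]; linarith [hx i j]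
  · intro i j
    rw [abs_neg, abs_one]
    rcases Fin.eq_zero_or_eq_succ i with rfl | ⟨i, rfl⟩ <;>
      rcases Fin.eq_zero_or_eq_succ j with rfl | ⟨j, rfl⟩
    · rw [bord_zz]; norm_num
    · rw [bord_zs, e0]; split_ifs <;> norm_num
    · rw [bord_sz, e0]; split_ifs <;> norm_num
    · rw [bord_ss]
      rcases Fin.eq_zero_or_eq_succ i with rfl | ⟨i, rfl⟩ <;>
        rcases Fin.eq_zero_or_eq_succ j with rfl | ⟨j, rfl⟩
      · rw [bord_zz, e0_z]; norm_num
      · rw [bord_zs, e0_s]; simpa using hb' j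
      · rw [bord_sz, e0_s]; simpa using hc i
      · rw [bord_ss, e0_s, e0_s]; simpa using hx i j

theorem trip_lev {n : ℕ} (c b : Fin n → ℝ) (N : Matrix (Fin n) (Fin n) ℝ) (d : Fin n → ℕ)
    (hb : ∀ j, b j = 0 ∨ b j = 1) (hc : ∀ i, lev (d i) (c i))
    (hx : ∀ i j, lev (d i) (N i j + c i * b j / 2)) (i j : Fin (n + 3)) :
    lev ((Fin.cons 0 (Fin.cons 0 (Fin.cons 0 d : Fin (n + 1) → ℕ) : Fin (n + 2) → ℕ) :
      Fin (n + 3) → ℕ) i) (trip c b N i j) := by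
  unfold trip
  rcases Fin.eq_zero_or_eq_succ i with rfl | ⟨i, rfl⟩ <;>
    rcases Fin.eq_zero_or_eq_succ j with rfl | ⟨j, rfl⟩
  · rw [bord_zz, Fin.cons_zero]; exact Or.inr rfl
  · rw [bord_zs, e0, Fin.cons_zero]; split_ifs
    · exact Or.inr rfl
    · exact Or.inl rfl
  · rw [bord_sz, Fin.cons_succ]
    rcases Fin.eq_zero_or_eq_succ i with rfl | ⟨i, rfl⟩
    · rw [e0_z, Fin.cons_zero]; exact Or.inr rfl
    · rw [e0_s]; exact lev_zero _
  · rw [bord_ss, Fin.cons_succ]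
    rcases Fin.eq_zero_or_eq_succ i with rfl | ⟨i, rfl⟩ <;>
      rcases Fin.eq_zero_or_eq_succ j with rfl | ⟨j, rfl⟩
    · rw [bord_zz, e0_z, Fin.cons_zero]; exact Or.inl (by norm_num)
    · rw [bord_zs, e0_s, e0, Fin.cons_zero]; split_ifs
      · exact Or.inr (by norm_num)
      · exact Or.inl (by norm_num)
    · rw [bord_sz, e0_s, Fin.cons_succ]
      rcases Fin.eq_zero_or_eq_succ i with rfl | ⟨i, rfl⟩
      · rw [e0_z, Fin.cons_zero]; exact Or.inr (by norm_num)
      · rw [e0_s]; simpa using lev_zero _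
    · rw [bord_ss, e0_s, e0_s, Fin.cons_succ]
      rcases Fin.eq_zero_or_eq_succ i with rfl | ⟨i, rfl⟩ <;>
        rcases Fin.eq_zero_or_eq_succ j with rfl | ⟨j, rfl⟩
      · rw [bord_zz, e0_z, Fin.cons_zero]; exact Or.inr (by norm_num)
      · rw [bord_zs, e0_s, Fin.cons_zero]; simpa [lev] using hb j
      · rw [bord_sz, e0_s, Fin.cons_succ]; simpa using hc i
      · rw [bord_ss, e0_s, e0_s, Fin.cons_succ]; simpa using hx i j

theorem lift_all (γ : ℝ) : ∀ (s k : ℕ) (N : Matrix (Fin k) (Fin k) ℝ) (d : Fin k → ℕ),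
    ∑ i, d i = s → RCP k N → RP k N γ → (∀ i j, lev (d i) (N i j)) →
    ∃ k' ≤ k + 3 * s, ∃ Z : Matrix (Fin k') (Fin k') ℝ, RCP k' Z ∧ RP k' Z γ ∧
      ∀ i j, Z i j = 0 ∨ Z i j = 1 := by
  intro s
  induction s with
  | zero =>
    intro k N d hd hN hP hl
    refine ⟨k, by omega, N, hN, hP, fun i j => ?_⟩
    have : d i = 0 := by
      have := Finset.sum_eq_zero_iff.1 hd i (Finset.mem_univ _)
      exact this
    have h := hl i j
    rw [this] at h
    exact h
  | succ s ih =>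
    intro k N d hd hN hP hl
    obtain ⟨i, hi⟩ : ∃ i, d i ≠ 0 := by
      by_contra! h
      simp [h] at hd
    have hsum : ∀ v, d i = v + 1 → ∑ i', Function.update d i v i' = s := by
      intro v hv
      have h1 := Finset.sum_update_of_mem (Finset.mem_univ i) d v
      have h2 := Finset.add_sum_erase Finset.univ d (Finset.mem_univ i)
      rw [← Finset.erase_eq] at h1
      omega
    rcases hdi : d i with _ | _ | K
    · exact (hi hdi).elim
    · -- level one
      set r : Fin k → ℝ := fun j => if N i j = -1 then 1 else 0 with hr
      set c : Fin k → ℝ := fun i' => if i' = i then 1 else 0 with hcdef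
      have hlev : ∀ i' j', lev ((Fin.cons 0 (Function.update d i 0) : Fin (k + 1) → ℕ) i')
          (bord 1 c r N i' j') := by
        refine Fin.cases (Fin.cases ?_ fun j => ?_) (fun i' => Fin.cases ?_ fun j => ?_)
        · simp [bord_zz, lev]
        · simp only [bord_zs, Fin.cons_zero, lev, hr]; split_ifs <;> norm_num
        · simp only [bord_sz, Fin.cons_succ, hcdef]
          split_ifs with h
          · subst h; simp [lev]
          · exact lev_zero _
        · simp only [bord_ss, Fin.cons_succ, hcdef]
          by_cases h : i' = i
          · subst h
            have h1 := hl i' j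
            rw [hdi] at h1
            obtain ⟨h2, z, hz⟩ := h1
            simp only [pow_zero, div_one] at hz
            rw [hz] at h2
            have h3 : |z| ≤ 1 := by exact_mod_cast h2
            rw [abs_le] at h3
            have h4 : z = -1 ∨ z = 0 ∨ z = 1 := by omega
            simp only [Function.update_self, lev, hr, hz]
            rcases h4 with rfl | rfl | rfl <;> norm_num
          · simp only [h, if_false, Function.update_of_ne (h : i' ≠ i)]
            simpa using hl i' j
      obtain ⟨k', hk', Z, hZ⟩ := ih (k + 1) (bord 1 c r N) (Fin.cons 0 (Function.update d i 0))
        (by rw [Fin.sum_univ_succ]; simpa using hsum 0 hdi)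
        (RCP_bord _ _ _ _ one_ne_zero hN (fun i' j' => by
          simpa using lev_abs _ _ (hlev i' j')))
        (RP_bord _ _ _ _ _ hP) hlev
      exact ⟨k', by omega, Z, hZ⟩
    · have hz : ∀ j, ∃ z : ℤ, N i j = z / 2 ^ (K + 1) := fun j => by
        have := hl i j
        rw [hdi] at this
        exact this.2
      choose z hz using hz
      set b : Fin k → ℝ := fun j => ((z j % 2 : ℤ) : ℝ) with hbdef
      set c : Fin k → ℝ := fun i' => if i' = i then 1 / 2 ^ K else 0 with hcdef
      have hb : ∀ j, b j = 0 ∨ b j = 1 := by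
        intro j
        rcases Int.emod_two_eq_zero_or_one (z j) with h | h <;> simp [hbdef, h]
      have h2K : (1 : ℝ) ≤ 2 ^ K := one_le_pow₀ (by norm_num)
      have hc : ∀ i', lev (Function.update d i (K + 1) i') (c i') := by
        intro i'
        simp only [hcdef]
        split_ifs with h
        · subst h
          simp only [Function.update_self, lev]
          refine ⟨?_, 1, by simp⟩
          rw [abs_of_pos (by positivity)]
          exact div_le_one_of_le₀ h2K (by positivity)
        · exact lev_zero _
      have hx : ∀ i' j, lev (Function.update d i (K + 1) i') (N i' j + c i' * b j / 2) := by
        intro i' j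
        simp only [hcdef]
        by_cases h : i' = i
        · subst h
          simp only [Function.update_self, lev, if_true]
          have h1 := (lev_abs _ _ (hl i' j))
          rw [hz j, abs_le, le_div_iff₀ (by positivity), div_le_iff₀ (by positivity)] at h1
          have h2 : -(2 ^ (K + 1)) ≤ z j ∧ z j ≤ 2 ^ (K + 1) := by
            constructor
            · have := h1.1; rw [neg_one_mul] at this; exact_mod_cast this
            · have := h1.2; rw [one_mul] at this; exact_mod_cast this
          have e : N i' j + 1 / 2 ^ K * b j / 2 = ((z j / 2 + z j % 2 : ℤ) : ℝ) / 2 ^ K := by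
            have h3 : (z j : ℝ) = 2 * ((z j / 2 : ℤ) : ℝ) + ((z j % 2 : ℤ) : ℝ) := by
              exact_mod_cast (Int.mul_ediv_add_emod (z j) 2).symm
            rw [hz j, hbdef, h3]
            push_cast
            field_simp
            ring
          rw [e]
          refine ⟨?_, _, rfl⟩
          rw [abs_div, abs_of_pos (show (0 : ℝ) < 2 ^ K by positivity),
            div_le_one (by positivity)]
          have h5 : |z j / 2 + z j % 2| ≤ 2 ^ K := by
            rw [abs_le]
            rw [pow_succ] at h2
            constructor <;> omega
          exact_mod_cast h5
        · simp only [h, if_false, Function.update_of_ne (h : i' ≠ i)]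
          simpa using hl i' j
      obtain ⟨k', hk', Z, hZ⟩ := ih (k + 3) (trip c b N)
        (Fin.cons 0 (Fin.cons 0 (Fin.cons 0 (Function.update d i (K + 1)) : Fin (k + 1) → ℕ) :
          Fin (k + 2) → ℕ))
        (by
          rw [Fin.sum_univ_succ, Fin.sum_univ_succ, Fin.sum_univ_succ]
          simp only [Fin.cons_zero, Fin.cons_succ, zero_add]
          exact hsum (K + 1) hdi)
        (trip_RCP c b N hb (fun i' => lev_abs _ _ (hc i')) (fun i' j => lev_abs _ _ (hx i' j)) hN
          (fun i' j => lev_abs _ _ (trip_lev c b N _ hb hc hx i' j)))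
        (RP_bord _ _ _ _ _ (RP_bord _ _ _ _ _ (RP_bord _ _ _ _ _ hP)))
        (trip_lev c b N _ hb hc hx)
      exact ⟨k', by omega, Z, hZ⟩

theorem pad (γ : ℝ) (k : ℕ) (Z : Matrix (Fin k) (Fin k) ℝ) (h1 : RCP k Z) (h2 : RP k Z γ)
    (h3 : ∀ i j, Z i j = 0 ∨ Z i j = 1) (e : ℕ) :
    ∃ Z : Matrix (Fin (k + e)) (Fin (k + e)) ℝ, RCP (k + e) Z ∧ RP (k + e) Z γ ∧
      ∀ i j, Z i j = 0 ∨ Z i j = 1 := by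
  induction e with
  | zero => exact ⟨Z, h1, h2, h3⟩
  | succ e ih =>
    obtain ⟨Y, y1, y2, y3⟩ := ih
    have h : ∀ i j, bord 1 0 0 Y i j = 0 ∨ bord 1 0 0 Y i j = 1 := by
      refine Fin.cases (Fin.cases ?_ fun j => ?_) (fun i => Fin.cases ?_ fun j => ?_)
      · simp [bord_zz]
      · simp [bord_zs]
      · simp [bord_sz]
      · simpa [bord_ss] using y3 i j
    refine ⟨bord 1 0 0 Y, RCP_bord _ _ _ _ one_ne_zero y1 ?_, RP_bord _ _ _ _ _ y2, h⟩
    intro i j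
    rcases h i j with h | h <;> simp [h]

/-- Rounding a scaled completely pivoted matrix and lifting it to a zero-one matrix. -/
theorem core (n : ℕ) (A : Matrix (Fin (n + 1)) (Fin (n + 1)) ℝ) (hA : RCP (n + 1) A)
    (h1 : |A 0 0| = 1) (hγ : 1 ≤ lastp n A) :
    ∃ k ≤ 4 * (n + 1) * (3 * (n + 1) + 1), ∃ Z : Matrix (Fin k) (Fin k) ℝ,
      RCP k Z ∧ RP k Z (lastp n A / 2) ∧ ∀ i j, Z i j = 0 ∨ Z i j = 1 := by
  set γ := lastp n A with hγdef
  set K := 4 * (n + 1) with hK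
  set θ : ℝ := 1 - 1 / (4 * (n + 1)) with hθ
  have hn : (0 : ℝ) ≤ n := Nat.cast_nonneg n
  have hf : 1 / (4 * ((n : ℝ) + 1)) ≤ 1 / 4 := by
    apply div_le_div_of_nonneg_left <;> linarith
  have hf0 : 0 < 1 / (4 * ((n : ℝ) + 1)) := by positivity
  have hθ0 : 0 < θ := by rw [hθ]; linarith
  have hθ1 : θ < 1 := by rw [hθ]; linarith
  have hbern : 1 / 2 + 1 / (2 * ((n : ℝ) + 1)) ≤ (θ ^ 2) ^ n := by
    have := one_add_mul_le_pow (a := -(1 / (4 * ((n : ℝ) + 1)))) (by linarith) (2 * n)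
    rw [← pow_mul]
    have e : θ = 1 + -(1 / (4 * ((n : ℝ) + 1))) := by rw [hθ]; ring
    rw [e]
    refine le_trans (le_of_eq ?_) this
    push_cast
    field_simp
    ring
  have hpow : ((n : ℝ) + 1) ≤ 2 ^ n := by
    have := Nat.lt_two_pow_self (n := n)
    exact_mod_cast this
  set ε : ℝ := 1 / 2 ^ K with hε
  have hε4 : ε = 1 / (16 * 16 ^ n) := by
    rw [hε, hK, pow_mul, pow_succ]; norm_num [mul_comm]
  have h416 : (16 : ℝ) ^ n = 4 ^ n * (2 ^ n * 2 ^ n) := by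
    rw [← mul_pow, ← mul_pow]; norm_num
  have hεn : 4 ^ n * ε = 1 / (16 * (2 ^ n * 2 ^ n)) := by
    rw [hε4, h416]; field_simp
  have hεp : 0 < ε := by positivity
  set A' : Matrix (Fin (n + 1)) (Fin (n + 1)) ℝ :=
    fun i j => (⌊2 ^ K * (θ ^ (i.1) * θ ^ (j.1) * A i j)⌋ : ℝ) / 2 ^ K with hA'
  have hent : ∀ i j : Fin (n + 1), |θ ^ (i.1) * θ ^ (j.1) * A i j| ≤ 1 := by
    intro i j
    rw [abs_mul, abs_mul, abs_of_pos (pow_pos hθ0 _), abs_of_pos (pow_pos hθ0 _)]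
    have a1 : θ ^ i.1 ≤ 1 := pow_le_one₀ hθ0.le hθ1.le
    have a2 : θ ^ j.1 ≤ 1 := pow_le_one₀ hθ0.le hθ1.le
    have a3 : |A i j| ≤ 1 := h1 ▸ hA.2.1 i j
    exact mul_le_one₀ (mul_le_one₀ a1 (pow_nonneg hθ0.le _) a2) (abs_nonneg _) a3
  have hp := pert n A A' 1 θ ε hA hθ0 hθ1 one_pos hεp ?_ ?_
  · have hlast : γ / 2 ≤ lastp n A' := by
      refine le_trans ?_ hp.2
      rw [← hγdef, one_mul, hεn]
      have h5 : 1 / (16 * ((2 : ℝ) ^ n * 2 ^ n)) ≤ 1 / (2 * ((n : ℝ) + 1)) := by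
        apply one_div_le_one_div_of_le (by positivity)
        have : (1 : ℝ) ≤ 2 ^ n := one_le_pow₀ (by norm_num)
        nlinarith
      have h6 : 0 < 1 / (2 * ((n : ℝ) + 1)) := by positivity
      nlinarith
    obtain ⟨k, hk, Z, hZ⟩ := lift_all (γ / 2) ((n + 1) * (K + 1)) (n + 1) A' (fun _ => K + 1)
      (by simp) hp.1 (RP_lastp n A' _ hlast) (fun i j => by
        have h2 := hent i j
        rw [abs_le] at h2
        have h3 : (0 : ℝ) < 2 ^ K := by positivity
        refine ⟨?_, _, rfl⟩
        rw [abs_le, le_div_iff₀ h3, div_le_iff₀ h3]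
        constructor
        · have : (-(2 ^ K) : ℤ) ≤ ⌊2 ^ K * (θ ^ (i.1) * θ ^ (j.1) * A i j)⌋ := by
            rw [Int.le_floor]; push_cast; nlinarith
          have h5 : ((-(2 ^ K) : ℤ) : ℝ) ≤ (⌊2 ^ K * (θ ^ (i.1) * θ ^ (j.1) * A i j)⌋ : ℝ) := by
            exact_mod_cast this
          push_cast at h5
          linarith
        · refine (Int.floor_le _).trans ?_
          nlinarith)
    refine ⟨k, hk.trans (le_of_eq ?_), Z, hZ⟩
    rw [hK]; ring
  · intro i j
    have h3 : (0 : ℝ) < 2 ^ K := by positivity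
    simp only [hA', one_mul]
    set x := θ ^ (i.1) * θ ^ (j.1) * A i j
    have a1 := Int.floor_le (2 ^ K * x)
    have a2 := Int.lt_floor_add_one (2 ^ K * x)
    have e : (⌊2 ^ K * x⌋ : ℝ) / 2 ^ K - x = (⌊2 ^ K * x⌋ - 2 ^ K * x) / 2 ^ K := by
      field_simp
    rw [e, abs_div, abs_of_pos h3, hε]
    gcongr
    rw [abs_le]
    constructor <;> linarith
  · rw [mul_assoc, hεn, one_mul, ← hγdef]
    have e : 1 - θ = 1 / (4 * ((n : ℝ) + 1)) := by rw [hθ]; ring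
    rw [e]
    have h6 : 0 < 1 / (2 * ((n : ℝ) + 1)) := by positivity
    calc 2 * (1 / (16 * ((2 : ℝ) ^ n * 2 ^ n))) = 1 / (4 * 2 ^ n) * (1 / 2) * 1 / 2 ^ n := by
          field_simp; norm_num
      _ ≤ 1 / (4 * ((n : ℝ) + 1)) * (θ ^ 2) ^ n * γ / 2 ^ n := by
          gcongr
          linarith

theorem num_le {n : ℕ} (A : Matrix (Fin n) (Fin n) ℝ) (k i j : Fin n) (hi : k.1 ≤ i.1)
    (hj : k.1 ≤ j.1) : |geIter A k.1 i j| ≤ ⨆ k : Fin n, ⨆ i : Fin n, ⨆ j : Fin n,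
      if k.1 ≤ i.1 ∧ k.1 ≤ j.1 then ‖geIter A k.1 i j‖ else 0 := by
  have h : |geIter A k.1 i j| = if k.1 ≤ i.1 ∧ k.1 ≤ j.1 then ‖geIter A k.1 i j‖ else 0 := by
    rw [if_pos ⟨hi, hj⟩, Real.norm_eq_abs]
  rw [h]
  refine le_trans ?_ (le_ciSup (Set.finite_range _).bddAbove k)
  refine le_trans ?_ (le_ciSup (Set.finite_range _).bddAbove i)
  exact le_ciSup (f := fun j : Fin n => if k.1 ≤ i.1 ∧ k.1 ≤ j.1 then ‖geIter A k.1 i j‖ else 0)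
    (Set.finite_range _).bddAbove j

theorem den_eq {n : ℕ} (A : Matrix (Fin (n + 1)) (Fin (n + 1)) ℝ)
    (h : ∀ i j, |A i j| ≤ |A 0 0|) : (⨆ i, ⨆ j, ‖A i j‖) = |A 0 0| := by
  apply le_antisymm
  · exact ciSup_le fun i => ciSup_le fun j => h i j
  · refine le_trans ?_ (le_ciSup (Set.finite_range _).bddAbove 0)
    exact le_ciSup (f := fun j => ‖A 0 j‖) (Set.finite_range _).bddAbove 0

theorem growth_le {n : ℕ} (A : Matrix (Fin (n + 1)) (Fin (n + 1)) ℝ) (hA : RCP (n + 1) A)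
    (x : ℝ) (hx : ∀ k i j : Fin (n + 1), k.1 ≤ i.1 → k.1 ≤ j.1 →
      |geIter A k.1 i j| / |A 0 0| ≤ x) : growth A ≤ x := by
  have hp : 0 < |A 0 0| := abs_pos.2 hA.1
  have hx0 : 0 ≤ x := le_trans (by positivity) (hx 0 0 0 le_rfl le_rfl)
  unfold growth
  rw [den_eq A hA.2.1, div_le_iff₀ hp]
  refine ciSup_le fun k => ciSup_le fun i => ciSup_le fun j => ?_
  split_ifs with h
  · have := hx k i j h.1 h.2
    rwa [div_le_iff₀ hp] at this
  · positivity

theorem growth_bdd_s3 {n : ℕ} (A : Matrix (Fin (n + 1)) (Fin (n + 1)) ℝ) (hA : RCP (n + 1) A) :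
    growth A ≤ 2 ^ n := by
  have hp : 0 < |A 0 0| := abs_pos.2 hA.1
  refine growth_le A hA _ fun k i j hi hj => ?_
  rw [div_le_iff₀ hp]
  refine (geIter_le _ A hA k.1 i j k.2 hi hj).trans ?_
  refine (lastp_le _ _ (RCP_sub _ _ k.2 A hA)).trans ?_
  have h0 : (A.submatrix (Fin.castLE k.2) (Fin.castLE k.2)) 0 0 = A 0 0 := rfl
  rw [h0]
  gcongr
  · norm_num
  · have := k.2; omega

/-- Zero-one matrices with at least half the growth. -/
theorem core2 (n : ℕ) (B : Matrix (Fin (n + 1)) (Fin (n + 1)) ℝ) (hB : RCP (n + 1) B)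
    (k i j : Fin (n + 1)) (hi : k.1 ≤ i.1) (hj : k.1 ≤ j.1) (M : ℕ)
    (hM : 4 * (n + 1) * (3 * (n + 1) + 1) ≤ M) :
    ∃ γ, |geIter B k.1 i j| / |B 0 0| / 2 ≤ γ ∧ ∃ Z : Matrix (Fin M) (Fin M) ℝ,
      RCP M Z ∧ RP M Z γ ∧ ∀ i j, Z i j = 0 ∨ Z i j = 1 := by
  have hp : 0 < |B 0 0| := abs_pos.2 hB.1
  have main : ∀ l (hl : l + 1 ≤ n + 1),
      1 ≤ lastp l (B.submatrix (Fin.castLE hl) (Fin.castLE hl)) / |B 0 0| →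
      ∃ Z : Matrix (Fin M) (Fin M) ℝ,
      RCP M Z ∧ RP M Z (lastp l (B.submatrix (Fin.castLE hl) (Fin.castLE hl)) / |B 0 0| / 2) ∧
        ∀ i j, Z i j = 0 ∨ Z i j = 1 := by
    intro l hl h
    set C := B.submatrix (Fin.castLE hl) (Fin.castLE hl) with hC
    have hc0 : (B 0 0)⁻¹ ≠ 0 := inv_ne_zero hB.1
    have hL : lastp l ((B 0 0)⁻¹ • C) = lastp l C / |B 0 0| := by
      rw [lastp_smul l C _ hc0, abs_inv]; ring
    obtain ⟨k', hk', Z, z1, z2, z3⟩ := core l ((B 0 0)⁻¹ • C)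
      (RCP_smul _ _ _ hc0 (RCP_sub _ _ hl B hB))
      (by
        have : C 0 0 = B 0 0 := rfl
        simp [this, hB.1]) (by rw [hL]; exact h)
    rw [hL] at z2
    have hkM : k' ≤ M := by
      refine hk'.trans (le_trans ?_ hM)
      gcongr
    obtain ⟨e, rfl⟩ := Nat.exists_eq_add_of_le hkM
    exact pad _ k' Z z1 z2 z3 e
  have hg := geIter_le _ B hB k.1 i j k.2 hi hj
  by_cases h : 1 ≤ lastp k.1 (B.submatrix (Fin.castLE k.2) (Fin.castLE k.2)) / |B 0 0|
  · exact ⟨_, by gcongr, main k.1 k.2 h⟩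
  · have e : lastp 0 (B.submatrix (Fin.castLE (Nat.le_add_left 1 n))
        (Fin.castLE (Nat.le_add_left 1 n))) = |B 0 0| := rfl
    refine ⟨_, ?_, main 0 (by omega) ?_⟩
    · rw [e, div_self hp.ne']
      gcongr
      refine le_trans ?_ (not_le.1 h).le
      gcongr
    · rw [e, div_self hp.ne']

theorem entries_S (S : Set ℝ) (a b : ℝ) (ha : a ∈ S) (hb : b ∈ S) (hab : a ≠ b)
    (hle : |a| ≤ |b|) (M : ℕ) (Z : Matrix (Fin M) (Fin M) ℝ) (γ : ℝ) (h1 : RCP M Z)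
    (h2 : RP M Z γ) (h3 : ∀ i j, Z i j = 0 ∨ Z i j = 1) :
    ∃ A : Matrix (Fin (M + 1)) (Fin (M + 1)) ℝ, RCP (M + 1) A ∧ (∀ i j, A i j ∈ S) ∧
      |a - b| * γ / |b| ≤ growth A := by
  have hb0 : b ≠ 0 := by
    rintro rfl
    apply hab
    simpa using hle
  have hs : a - b ≠ 0 := sub_ne_zero.2 hab
  set A := bord b (fun _ => b) (fun _ => b) ((a - b) • Z) with hA
  have hent : ∀ i j, A i j = a ∨ A i j = b := by
    rw [hA]
    refine Fin.cases (Fin.cases ?_ fun j => ?_) (fun i => Fin.cases ?_ fun j => ?_)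
    · simp [bord_zz]
    · simp [bord_zs]
    · simp [bord_sz]
    · simp only [bord_ss, Matrix.smul_apply, smul_eq_mul]
      rw [mul_div_cancel_right₀ b hb0]
      rcases h3 i j with h | h <;> simp [h]
  have hdom : ∀ i j, |A i j| ≤ |b| := by
    intro i j
    rcases hent i j with h | h <;> rw [h]
    exact hle
  have hR : RCP (M + 1) A := RCP_bord _ _ _ _ hb0 (RCP_smul _ _ _ hs h1) hdom
  refine ⟨A, hR, ?_, ?_⟩
  · intro i j
    rcases hent i j with h | h <;> rw [h] <;> assumption
  · obtain ⟨k, hk⟩ := RP_geIter _ A _ (RP_bord b (fun _ => b) (fun _ => b) _ _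
      (RP_smul _ _ _ _ hs h2))
    have := num_le A k k k le_rfl le_rfl
    unfold growth
    rw [den_eq A hR.2.1]
    have e : A 0 0 = b := rfl
    rw [e]
    gcongr
    exact hk.trans this

/-- for compact `S ⊆ ℝ` with at least two points,
`g[CP_m(S)] ≥ (diam(S) / (2 max_{s ∈ S} |s|)) · g[CP_n(ℝ)]` for every `n ≥ 1` and
`m > 4n(3n+1)`. -/
theorem restricted_entries_growth (S : Set ℝ) (hScomp : IsCompact S)
    (s₁ s₂ : ℝ) (hs₁ : s₁ ∈ S) (hs₂ : s₂ ∈ S) (hne : s₁ ≠ s₂)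
    (n : ℕ) (hn : 1 ≤ n) (m : ℕ) (hm : 4 * n * (3 * n + 1) < m) :
    sSup {x : ℝ | ∃ s ∈ S, ∃ t ∈ S, x = |s - t|} /
        (2 * sSup {x : ℝ | ∃ s ∈ S, x = |s|}) * gCP ℝ n ≤
      sSup (growth '' {A : Matrix (Fin m) (Fin m) ℝ | IsCP A ∧ ∀ i j, A i j ∈ S}) := by
  obtain ⟨n, rfl⟩ : ∃ l, n = l + 1 := ⟨n - 1, by omega⟩
  obtain ⟨m, rfl⟩ : ∃ l, m = l + 1 := ⟨m - 1, by omega⟩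
  -- attained diameter
  obtain ⟨⟨a, b⟩, ⟨ha, hb⟩, hmax⟩ := (hScomp.prod hScomp).exists_isMaxOn ⟨(s₁, s₂), hs₁, hs₂⟩
    (f := fun q : ℝ × ℝ => |q.1 - q.2|) (by fun_prop)
  have hmax' : ∀ s ∈ S, ∀ t ∈ S, |s - t| ≤ |a - b| := fun s hs t ht => hmax (Set.mk_mem_prod hs ht)
  clear hmax
  simp only at ha hb
  have hab : a ≠ b := by
    rintro rfl
    have := hmax' s₁ hs₁ s₂ hs₂
    simp only [sub_self, abs_zero, abs_nonpos_iff] at this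
    exact hne (sub_eq_zero.1 this)
  wlog hle : |a| ≤ |b| generalizing a b
  · exact this b a hb ha (fun s hs t ht => by rw [abs_sub_comm b a]; exact hmax' s hs t ht)
      hab.symm (not_le.1 hle).le
  have hb0 : 0 < |b| := by
    rw [abs_pos]
    rintro rfl
    apply hab
    simpa using hle
  have hdiam : sSup {x : ℝ | ∃ s ∈ S, ∃ t ∈ S, x = |s - t|} ≤ |a - b| := by
    refine csSup_le ⟨_, a, ha, b, hb, rfl⟩ ?_
    rintro x ⟨s, hs, t, ht, rfl⟩
    exact hmax' s hs t ht
  have hmx : |b| ≤ sSup {x : ℝ | ∃ s ∈ S, x = |s|} := by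
    refine le_csSup ?_ ⟨b, hb, rfl⟩
    obtain ⟨C, hC⟩ := hScomp.isBounded.exists_norm_le
    refine ⟨C, ?_⟩
    rintro x ⟨s, hs, rfl⟩
    exact hC s hs
  set T := growth '' {A : Matrix (Fin (m + 1)) (Fin (m + 1)) ℝ | IsCP A ∧ ∀ i j, A i j ∈ S} with hT
  have hTb : BddAbove T := by
    refine ⟨2 ^ m, ?_⟩
    rintro _ ⟨A, ⟨hA, _⟩, rfl⟩
    exact growth_bdd_s3 A ((isCP_iff _ _).1 hA)
  have hd : 0 < |a - b| := abs_pos.2 (sub_ne_zero.2 hab)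
  have key : gCP ℝ (n + 1) ≤ sSup T * (2 * |b|) / |a - b| := by
    unfold gCP
    refine csSup_le ⟨_, 1, ?_, rfl⟩ ?_
    · rw [Set.mem_setOf_eq, isCP_iff]
      have hone : ∀ l, RCP l 1 := by
        intro l
        induction l with
        | zero => trivial
        | succ l ih =>
          refine ⟨by simp, fun i j => ?_, ?_⟩
          · rw [Matrix.one_apply]; split_ifs <;> simp
          · have : sch (1 : Matrix (Fin (l + 1)) (Fin (l + 1)) ℝ) = 1 := by
              ext i j
              simp [sch, Matrix.one_apply, Fin.succ_ne_zero]
            rw [this]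
            exact ih
      exact hone _
    · rintro _ ⟨B, hB, rfl⟩
      rw [Set.mem_setOf_eq, isCP_iff] at hB
      refine growth_le B hB _ fun k i j hi hj => ?_
      obtain ⟨γ, hγ, Z, z1, z2, z3⟩ := core2 n B hB k i j hi hj m (by omega)
      obtain ⟨A, hA, hAS, hg⟩ := entries_S S a b ha hb hab hle m Z γ z1 z2 z3
      have h1 : growth A ≤ sSup T := le_csSup hTb ⟨A, ⟨(isCP_iff _ _).2 hA, hAS⟩, rfl⟩
      have h2 := hg.trans h1
      rw [div_le_iff₀ hb0] at h2
      rw [le_div_iff₀ hd]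
      nlinarith
  have hg0 : 0 ≤ gCP ℝ (n + 1) := by
    unfold gCP
    apply Real.sSup_nonneg
    rintro _ ⟨B, hB, rfl⟩
    unfold growth
    refine div_nonneg ?_ ?_
    · refine Real.iSup_nonneg fun k => Real.iSup_nonneg fun i => Real.iSup_nonneg fun j => ?_
      split_ifs <;> positivity
    · exact Real.iSup_nonneg fun i => Real.iSup_nonneg fun j => norm_nonneg _
  calc _ ≤ |a - b| / (2 * |b|) * gCP ℝ (n + 1) := by
        gcongr
    _ ≤ |a - b| / (2 * |b|) * (sSup T * (2 * |b|) / |a - b|) := by gcongr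
    _ = sSup T := by field_simp
end

section
/- Let 𝕜 be ℝ or ℂ, and let ε = (ε_1,…,ε_{n−1}) and δ = (δ_1,…,δ_{n−1}) satisfy −1 < δ_i ≤ 0 ≤ ε_i for i = 1,…,n−1. Then for every A ∈ CP^ε_n(𝕜) there exists a matrix B ∈ CP^δ_n(𝕜) such that b^{(k)}_{n,n} = a^{(k)}_{n,n} for all k = 1,…,n, and for all k and all i,j ≥ k: |b^{(k)}_{i,j} − a^{(k)}_{i,j}| ≤ max over ℓ with min(i,j) ≤ ℓ ≤ n−1 of { [((1+ε_ℓ)/(1+δ_ℓ))² − 1]·|a^{(ℓ)}_{ℓ,ℓ}| / ∏_{p=min(i,j)}^{ℓ−1}(1+δ_p) + Σ_{m=min(i,j)}^{ℓ−1} (ε_m − δ_m)·|a^{(m)}_{m,m}| / ∏_{p=min(i,j)}^{m}(1+δ_p) }. -/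
open scoped BigOperators

/-- `A ∈ CP^ε_n(𝕜)`: almost completely pivoted with tolerance `ε k` at step `k`
(0-indexed, so `ε 0` is the paper's `ε_1`). -/
def IsCPeps {𝕜 : Type*} [RCLike 𝕜] {n : ℕ} (ε : ℕ → ℝ)
    (A : Matrix (Fin n) (Fin n) 𝕜) : Prop :=
  A.det ≠ 0 ∧ (∀ k : ℕ, k + 1 < n → pivotNorm A k ≠ 0) ∧
    ∀ (k : ℕ) (i j : Fin n), k ≤ i.1 → k ≤ j.1 → ¬(i.1 = k ∧ j.1 = k) →
      ‖geIter A k i j‖ ≤ (1 + ε k) * pivotNorm A k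


section helpers

variable {𝕜 : Type*} [RCLike 𝕜] {n : ℕ}

theorem geIter_succ_of_lt (A : Matrix (Fin n) (Fin n) 𝕜) (k : ℕ) (i j : Fin n)
    (hk : k < n) (hi : k + 1 ≤ i.1) (hj : k + 1 ≤ j.1) :
    geIter A (k + 1) i j = geIter A k i j -
      geIter A k i ⟨k, hk⟩ * geIter A k ⟨k, hk⟩ j / geIter A k ⟨k, hk⟩ ⟨k, hk⟩ := by
  exact dif_pos ⟨hk, hi, hj⟩

/-- lower factor -/
noncomputable def cpL (A : Matrix (Fin n) (Fin n) 𝕜) : Matrix (Fin n) (Fin n) 𝕜 := fun i k =>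
  if i = k then 1 else if k < i then geIter A k.1 i k / geIter A k.1 k k else 0

/-- upper factor -/
noncomputable def cpU (A : Matrix (Fin n) (Fin n) 𝕜) : Matrix (Fin n) (Fin n) 𝕜 := fun k j =>
  if k ≤ j then geIter A k.1 k j else 0

theorem cp_telescope (A : Matrix (Fin n) (Fin n) 𝕜) (i j : Fin n) (m : ℕ)
    (hi : m ≤ i.1) (hj : m ≤ j.1) :
    A i j = (∑ k ∈ Finset.range m, if h : k < n then cpL A i ⟨k, h⟩ * cpU A ⟨k, h⟩ j else 0)
      + geIter A m i j := by
  induction m with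
  | zero => simp [geIter]
  | succ m ih =>
    have hm : m < n := by omega
    rw [Finset.sum_range_succ, dif_pos hm, geIter_succ_of_lt A m i j hm hi hj]
    rw [ih (by omega) (by omega)]
    have h1 : ¬ (i = ⟨m, hm⟩) := by intro h; rw [h] at hi; simp at hi
    have h2 : (⟨m, hm⟩ : Fin n) < i := by rw [Fin.lt_def]; simp; omega
    have h3 : (⟨m, hm⟩ : Fin n) ≤ j := by rw [Fin.le_def]; simp; omega
    simp only [cpL, cpU, h1, h2, h3, if_true, if_false]
    ring

theorem cp_LU (A : Matrix (Fin n) (Fin n) 𝕜)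
    (hp : ∀ k : Fin n, k.1 + 1 < n → geIter A k.1 k k ≠ 0) : A = cpL A * cpU A := by
  ext i j
  rw [Matrix.mul_apply]
  have e : ∑ k : Fin n, cpL A i k * cpU A k j =
      ∑ k ∈ Finset.range n, if h : k < n then cpL A i ⟨k, h⟩ * cpU A ⟨k, h⟩ j else 0 := by
    rw [← Fin.sum_univ_eq_sum_range
      (fun k => if h : k < n then cpL A i ⟨k, h⟩ * cpU A ⟨k, h⟩ j else 0)]
    apply Finset.sum_congr rfl
    intro k _
    simp
  have hmn : min i.1 j.1 + 1 ≤ n := by omega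
  have e2 := Finset.sum_subset (f := fun k => if h : k < n then
      cpL A i ⟨k, h⟩ * cpU A ⟨k, h⟩ j else 0) (Finset.range_mono hmn) (by
    intro k hk hk2
    simp only [Finset.mem_range] at hk hk2
    simp only [hk, dif_pos]
    rcases le_total i.1 j.1 with h | h
    · have h1 : ¬ (i = ⟨k, hk⟩) := by intro h; rw [Fin.ext_iff] at h; simp at h; omega
      have h2 : ¬ (⟨k, hk⟩ : Fin n) < i := by rw [Fin.lt_def]; simp; omega
      simp [cpL, h1, h2]
    · have h3 : ¬ (⟨k, hk⟩ : Fin n) ≤ j := by rw [Fin.le_def]; simp; omega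
      simp [cpU, h3])
  rw [e, ← e2, Finset.sum_range_succ,
    cp_telescope A i j (min i.1 j.1) (min_le_left _ _) (min_le_right _ _)]
  congr 1
  have hm : min i.1 j.1 < n := by omega
  rw [dif_pos hm]
  rcases le_or_gt i j with h | h
  · have h' : min i.1 j.1 = i.1 := min_eq_left h
    have h2 : (⟨min i.1 j.1, hm⟩ : Fin n) = i := Fin.ext h'
    rw [h2, h']
    simp [cpL, cpU, h]
  · have h' : min i.1 j.1 = j.1 := min_eq_right (le_of_lt h)
    have h2 : (⟨min i.1 j.1, hm⟩ : Fin n) = j := Fin.ext h'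
    rw [h2, h']
    have := hp j (by have := Fin.lt_def.1 h; omega)
    simp only [cpL, cpU, h, ne_of_gt h, if_true, if_false, le_refl]
    field_simp

theorem cp_det (A : Matrix (Fin n) (Fin n) 𝕜)
    (hp : ∀ k : Fin n, k.1 + 1 < n → geIter A k.1 k k ≠ 0) :
    A.det = ∏ k : Fin n, geIter A k.1 k k := by
  conv_lhs => rw [cp_LU A hp]
  rw [Matrix.det_mul, Matrix.det_of_lowerTriangular, Matrix.det_of_upperTriangular]
  · simp [cpL, cpU]
  · intro i j h
    have h' : ¬ i ≤ j := not_le.2 h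
    simp [cpU, h']
  · intro i j h
    have h' : i < j := h
    have h1 : i ≠ j := ne_of_lt h'
    have h2 : ¬ j < i := not_lt.2 (le_of_lt h')
    simp [cpL, h1, h2]

/-- the correction term -/
noncomputable def cpCor (A : Matrix (Fin n) (Fin n) 𝕜) (r : ℕ → ℝ) :
    Matrix (Fin n) (Fin n) 𝕜 := fun i j =>
  (((if i = j then (r i.1) ^ 2 - 1 else r (min i.1 j.1) - 1 : ℝ)) : 𝕜) *
    geIter A (min i.1 j.1) i j

theorem cpCor_diag (A : Matrix (Fin n) (Fin n) 𝕜) (r : ℕ → ℝ) (k : Fin n) :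
    geIter A k.1 k k + cpCor A r k k = (r k.1 : 𝕜) ^ 2 * geIter A k.1 k k := by
  simp [cpCor]; ring

theorem cpCor_off (A : Matrix (Fin n) (Fin n) 𝕜) (r : ℕ → ℝ) (k : ℕ) (i j : Fin n)
    (hij : i ≠ j) (hk : min i.1 j.1 = k) :
    geIter A k i j + cpCor A r i j = (r k : 𝕜) * geIter A k i j := by
  simp [cpCor, hij, hk]; ring

theorem geIter_cor (A : Matrix (Fin n) (Fin n) 𝕜) (r : ℕ → ℝ) (hr : ∀ k, r k ≠ 0)
    (k : ℕ) : ∀ (i j : Fin n), k ≤ i.1 → k ≤ j.1 →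
    geIter (A + cpCor A r) k i j = geIter A k i j + cpCor A r i j := by
  induction k with
  | zero => intro i j _ _; simp [geIter]
  | succ k ih =>
    intro i j hi hj
    have hk : k < n := by omega
    have hik : i ≠ ⟨k, hk⟩ := by intro h; rw [h] at hi; simp at hi
    have hjk : (⟨k, hk⟩ : Fin n) ≠ j := by intro h; rw [← h] at hj; simp at hj
    rw [geIter_succ_of_lt _ k i j hk hi hj, geIter_succ_of_lt _ k i j hk hi hj,
      ih i j (by omega) (by omega), ih i ⟨k, hk⟩ (by omega) le_rfl,
      ih ⟨k, hk⟩ j le_rfl (by omega), ih ⟨k, hk⟩ ⟨k, hk⟩ le_rfl le_rfl,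
      cpCor_off A r k i ⟨k, hk⟩ hik (by simp; omega),
      cpCor_off A r k ⟨k, hk⟩ j hjk (by simp; omega),
      cpCor_diag A r ⟨k, hk⟩]
    have h0 : (r k : 𝕜) ≠ 0 := by exact_mod_cast hr k
    have : (r k : 𝕜) * geIter A k i ⟨k, hk⟩ * ((r k : 𝕜) * geIter A k ⟨k, hk⟩ j) /
        ((r k : 𝕜) ^ 2 * geIter A k ⟨k, hk⟩ ⟨k, hk⟩) =
        geIter A k i ⟨k, hk⟩ * geIter A k ⟨k, hk⟩ j / geIter A k ⟨k, hk⟩ ⟨k, hk⟩ := by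
      rw [show (r k : 𝕜) * geIter A k i ⟨k, hk⟩ * ((r k : 𝕜) * geIter A k ⟨k, hk⟩ j) =
        (r k : 𝕜) ^ 2 * (geIter A k i ⟨k, hk⟩ * geIter A k ⟨k, hk⟩ j) by ring]
      exact mul_div_mul_left _ _ (pow_ne_zero 2 h0)
    simp only [this]
    ring

theorem cp_bdd (f : ℕ → ℝ) (a b : ℕ) :
    BddAbove (Set.range fun l => ⨆ (_ : l ∈ Finset.Icc a b), f l) := by
  apply Set.Finite.bddAbove
  apply Set.Finite.subset (((Finset.Icc a b).finite_toSet.image f).insert 0)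
  rintro _ ⟨l, rfl⟩
  by_cases h : l ∈ Finset.Icc a b
  · right
    exact ⟨l, h, by simp only [h, ciSup_unique]⟩
  · left
    simp only [h, Real.iSup_of_isEmpty]

theorem cp_le_sup (f : ℕ → ℝ) (a b l : ℕ) (h : l ∈ Finset.Icc a b) :
    f l ≤ ⨆ l ∈ Finset.Icc a b, f l := by
  refine le_trans (le_of_eq ?_) (le_ciSup (cp_bdd f a b) l)
  simp only [h, ciSup_unique]

theorem cp_sup_nonneg (f : ℕ → ℝ) (a b : ℕ) : 0 ≤ ⨆ l ∈ Finset.Icc a b, f l := by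
  refine le_trans (le_of_eq ?_) (le_ciSup (cp_bdd f a b) (b + 1))
  have h : ¬ (b + 1 ∈ Finset.Icc a b) := by simp
  simp only [h, Real.iSup_of_isEmpty]

theorem cp_sup_le (f : ℕ → ℝ) (a b : ℕ) (c : ℝ) (hc : 0 ≤ c)
    (h : ∀ l ∈ Finset.Icc a b, f l ≤ c) : ⨆ l ∈ Finset.Icc a b, f l ≤ c := by
  refine ciSup_le fun l => ?_
  by_cases hl : l ∈ Finset.Icc a b
  · simp only [hl, ciSup_unique]; exact h l hl
  · simp only [hl, Real.iSup_of_isEmpty]; exact hc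

/-- the quantity inside the maximum -/
noncomputable def cpF (ε δ p : ℕ → ℝ) (k l : ℕ) : ℝ :=
  (((1 + ε l) / (1 + δ l)) ^ 2 - 1) * p l / ∏ q ∈ Finset.Ico k l, (1 + δ q) +
    ∑ m ∈ Finset.Ico k l, (ε m - δ m) * p m / ∏ q ∈ Finset.Icc k m, (1 + δ q)

theorem cpF_self (ε δ p : ℕ → ℝ) (k : ℕ) :
    cpF ε δ p k k = (((1 + ε k) / (1 + δ k)) ^ 2 - 1) * p k := by
  simp [cpF]

theorem cpF_step (ε δ p : ℕ → ℝ) (k l : ℕ) (hkl : k < l) (h : 1 + δ k ≠ 0) :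
    cpF ε δ p (k + 1) l = (1 + δ k) * cpF ε δ p k l - (ε k - δ k) * p k := by
  unfold cpF
  rw [Finset.prod_eq_prod_Ico_succ_bot hkl, Finset.sum_eq_sum_Ico_succ_bot hkl]
  have e : ∑ m ∈ Finset.Ico (k + 1) l, (ε m - δ m) * p m / ∏ q ∈ Finset.Icc k m, (1 + δ q) =
      (∑ m ∈ Finset.Ico (k + 1) l,
        (ε m - δ m) * p m / ∏ q ∈ Finset.Icc (k + 1) m, (1 + δ q)) / (1 + δ k) := by
    rw [Finset.sum_div]
    apply Finset.sum_congr rfl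
    intro m hm
    have hm' := Finset.mem_Ico.1 hm
    have : ∏ q ∈ Finset.Icc k m, (1 + δ q) =
        (1 + δ k) * ∏ q ∈ Finset.Icc (k + 1) m, (1 + δ q) := by
      have := Finset.prod_eq_prod_Ico_succ_bot (show k < m + 1 by omega) (fun q => 1 + δ q)
      exact this
    rw [this, div_div, mul_comm (1 + δ k)]
  rw [e]
  simp only [Finset.Icc_self, Finset.prod_singleton]
  rw [mul_comm (1 + δ k) (∏ q ∈ _, _), ← div_div]
  field_simp
  ring

/-- the maximum -/
noncomputable def cpD (n : ℕ) (ε δ p : ℕ → ℝ) (k : ℕ) : ℝ :=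
  ⨆ l ∈ Finset.Icc k (n - 2), cpF ε δ p k l

theorem cpD_nonneg (ε δ p : ℕ → ℝ) (k : ℕ) : 0 ≤ cpD n ε δ p k := cp_sup_nonneg _ _ _

theorem cpD_self (ε δ p : ℕ → ℝ) (k : ℕ) (hk : k + 1 < n) :
    (((1 + ε k) / (1 + δ k)) ^ 2 - 1) * p k ≤ cpD n ε δ p k := by
  rw [← cpF_self]
  exact cp_le_sup _ _ _ _ (by simp; omega)

theorem cpD_step (ε δ p : ℕ → ℝ) (k : ℕ) (hk : k + 1 < n) (h1 : -1 < δ k) (h2 : δ k ≤ 0)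
    (h3 : 0 ≤ ε k) (hp : 0 ≤ p k) :
    cpD n ε δ p (k + 1) ≤ (1 + δ k) * cpD n ε δ p k - (ε k - δ k) * p k := by
  have hd : 0 < 1 + δ k := by linarith
  refine cp_sup_le _ _ _ _ ?_ ?_
  · have h := cpD_self (n := n) ε δ p k hk
    have hs : 1 ≤ (1 + ε k) / (1 + δ k) := by rw [le_div_iff₀ hd]; linarith
    have hs2 : (1 + δ k) * ((1 + ε k) / (1 + δ k)) = 1 + ε k := by field_simp
    set s := (1 + ε k) / (1 + δ k)
    have : (s - 1) * p k ≤ (s ^ 2 - 1) * p k := by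
      apply mul_le_mul_of_nonneg_right _ hp
      nlinarith
    have h4 := mul_le_mul_of_nonneg_left (this.trans h) hd.le
    have h5 : (1 + δ k) * ((s - 1) * p k) = (ε k - δ k) * p k := by
      have : (1 + δ k) * ((s - 1) * p k) = ((1 + δ k) * s - (1 + δ k)) * p k := by ring
      rw [this, hs2]; ring
    linarith
  · intro l hl
    have hl' := Finset.mem_Icc.1 hl
    rw [cpF_step ε δ p k l (by omega) hd.ne']
    have := cp_le_sup (cpF ε δ p k) k (n - 2) l (by simp; omega)
    have := mul_le_mul_of_nonneg_left this hd.le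
    unfold cpD
    linarith

end helpers

/-- the stability lemma.  Every `A ∈ CP^ε_n(𝕜)` is close to some
`B ∈ CP^δ_n(𝕜)`, with matching `(n,n)` trajectory entries, when
`-1 < δ_i ≤ 0 ≤ ε_i`.  (All indices are 0-indexed; paper index `ℓ` corresponds to `ℓ - 1`.) -/
theorem cp_eps_stable {𝕜 : Type*} [RCLike 𝕜] {n : ℕ} (hn : 1 ≤ n)
    (ε δ : ℕ → ℝ) (hδ : ∀ i, i + 1 < n → -1 < δ i ∧ δ i ≤ 0)
    (hε : ∀ i, i + 1 < n → 0 ≤ ε i)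
    (A : Matrix (Fin n) (Fin n) 𝕜) (hA : IsCPeps ε A) :
    ∃ B : Matrix (Fin n) (Fin n) 𝕜, IsCPeps δ B ∧
      (∀ k : ℕ, k < n →
        geIter B k ⟨n - 1, by omega⟩ ⟨n - 1, by omega⟩ =
          geIter A k ⟨n - 1, by omega⟩ ⟨n - 1, by omega⟩) ∧
      ∀ (k : ℕ) (i j : Fin n), k ≤ i.1 → k ≤ j.1 →
        ‖geIter B k i j - geIter A k i j‖ ≤
          ⨆ ℓ ∈ Finset.Icc (min i.1 j.1) (n - 2),
            ((((1 + ε ℓ) / (1 + δ ℓ)) ^ 2 - 1) * pivotNorm A ℓ /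
                ∏ p ∈ Finset.Ico (min i.1 j.1) ℓ, (1 + δ p) +
              ∑ m ∈ Finset.Ico (min i.1 j.1) ℓ,
                (ε m - δ m) * pivotNorm A m /
                  ∏ p ∈ Finset.Icc (min i.1 j.1) m, (1 + δ p)) := by
  classical
  obtain ⟨hdet, hpiv, hbd⟩ := hA
  have hpn : ∀ (k : Fin n), pivotNorm A k.1 = ‖geIter A k.1 k k‖ := by
    intro k; simp [pivotNorm]
  set p : ℕ → ℝ := pivotNorm A with hpdef
  have hp0 : ∀ k, 0 ≤ p k := by
    intro k; rw [hpdef]; unfold pivotNorm; split_ifs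
    · exact norm_nonneg _
    · exact le_rfl
  have hpp : ∀ k, k + 1 < n → 0 < p k := fun k hk => lt_of_le_of_ne (hp0 k) (Ne.symm (hpiv k hk))
  set D : ℕ → ℝ := cpD n ε δ p with hD
  have hD0 : ∀ k, 0 ≤ D k := fun k => cpD_nonneg (n := n) ε δ p k
  have hDs : ∀ k, k + 1 < n → D (k + 1) ≤ (1 + δ k) * D k - (ε k - δ k) * p k := fun k hk =>
    cpD_step ε δ p k hk (hδ k hk).1 (hδ k hk).2 (hε k hk) (hp0 k)
  have hDm : ∀ k, k + 1 < n → D (k + 1) ≤ D k := by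
    intro k hk
    have h1 := hDs k hk
    have h2 := hδ k hk
    have h3 := hε k hk
    nlinarith [mul_nonneg (sub_nonneg.2 (h2.2.trans h3)) (hp0 k),
      mul_nonneg (neg_nonneg.2 h2.2) (hD0 k)]
  have hDmono : ∀ a b, a ≤ b → b < n → D b ≤ D a := by
    intro a b hab
    induction b, hab using Nat.le_induction with
    | base => intro _; exact le_rfl
    | succ b _ ih => intro hb; exact (hDm b hb).trans (ih (by omega))
  set r : ℕ → ℝ := fun k => if k + 1 < n then Real.sqrt (1 + D k / p k) else 1 with hrdef
  have hr1 : ∀ k, 1 ≤ r k := by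
    intro k; rw [hrdef]; dsimp only; split_ifs with h
    · rw [Real.one_le_sqrt]
      have := div_nonneg (hD0 k) (hp0 k)
      linarith
    · exact le_rfl
  have hrsq : ∀ k, k + 1 < n → r k ^ 2 * p k = p k + D k := by
    intro k hk
    have hpk := hpp k hk
    have : 0 ≤ 1 + D k / p k := by have := div_nonneg (hD0 k) (hp0 k); linarith
    simp only [hrdef, hk, if_true]
    rw [Real.sq_sqrt this]
    field_simp
  have hrge : ∀ k, k + 1 < n → 1 + ε k ≤ r k * (1 + δ k) := by
    intro k hk
    have hd : 0 < 1 + δ k := by linarith [(hδ k hk).1]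
    rw [← div_le_iff₀ hd]
    have h : (((1 + ε k) / (1 + δ k)) ^ 2 - 1) * p k ≤ D k := cpD_self ε δ p k hk
    have h2 := hrsq k hk
    have h3 : ((1 + ε k) / (1 + δ k)) ^ 2 ≤ r k ^ 2 := by
      refine le_of_mul_le_mul_right ?_ (hpp k hk)
      linarith
    exact (abs_le_of_sq_le_sq' h3 (by linarith [hr1 k])).2
  have hr0 : ∀ k, r k ≠ 0 := fun k => by have := hr1 k; linarith
  have hG := geIter_cor A r hr0
  -- bound on the correction
  have hcor : ∀ i j : Fin n, ‖cpCor A r i j‖ ≤ D (min i.1 j.1) := by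
    intro i j
    by_cases hij : i = j
    · subst hij
      simp only [cpCor, if_true, min_self, norm_mul, RCLike.norm_ofReal]
      rw [abs_of_nonneg (by nlinarith [hr1 i.1]), ← hpn i]
      by_cases hi : i.1 + 1 < n
      · linarith [hrsq i.1 hi]
      · have : r i.1 = 1 := by simp [hrdef, hi]
        rw [this]; simpa using hD0 i.1
    · have hij' : i.1 ≠ j.1 := fun h => hij (Fin.ext h)
      set m := min i.1 j.1 with hm
      have hmn : m + 1 < n := by omega
      simp only [cpCor, hij, if_false, norm_mul, RCLike.norm_ofReal]
      rw [← hm, abs_of_nonneg (by linarith [hr1 m])]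
      have h1 := hbd m i j (by omega) (by omega) (by omega)
      have h2 : 1 + ε m ≤ r m := by
        nlinarith [hrge m hmn, hr1 m, (hδ m hmn).2]
      have h3 : (1 + ε m) * p m ≤ (r m + 1) * p m :=
        mul_le_mul_of_nonneg_right (by linarith) (hp0 m)
      have h4 := mul_le_mul_of_nonneg_left (h1.trans h3) (by linarith [hr1 m] : 0 ≤ r m - 1)
      have h5 := hrsq m hmn
      nlinarith
  have hBp : ∀ k : Fin n, geIter (A + cpCor A r) k.1 k k = (r k.1 : 𝕜) ^ 2 * geIter A k.1 k k := by
    intro k; rw [hG k.1 k k le_rfl le_rfl, cpCor_diag]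
  have hApiv : ∀ k : Fin n, k.1 + 1 < n → geIter A k.1 k k ≠ 0 := by
    intro k hk h
    apply hpiv k.1 hk
    rw [hpn k, h, norm_zero]
  have hApivall : ∀ k : Fin n, geIter A k.1 k k ≠ 0 := by
    rw [cp_det A hApiv, Finset.prod_ne_zero_iff] at hdet
    exact fun k => hdet k (Finset.mem_univ _)
  have hBpivall : ∀ k : Fin n, geIter (A + cpCor A r) k.1 k k ≠ 0 := by
    intro k
    rw [hBp k]
    exact mul_ne_zero (pow_ne_zero 2 (by exact_mod_cast hr0 k.1)) (hApivall k)
  have hBpn : ∀ k, k < n → pivotNorm (A + cpCor A r) k = r k ^ 2 * p k := by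
    intro k hk
    have h1 := hpn ⟨k, hk⟩
    have h2 := hBp ⟨k, hk⟩
    simp only at h1 h2
    rw [h1, pivotNorm, dif_pos hk, h2, norm_mul, norm_pow, RCLike.norm_ofReal, sq_abs]
  refine ⟨A + cpCor A r, ⟨?_, ?_, ?_⟩, ?_, ?_⟩
  · rw [cp_det _ (fun k _ => hBpivall k), Finset.prod_ne_zero_iff]
    exact fun k _ => hBpivall k
  · intro k hk
    rw [hBpn k (by omega)]
    exact mul_ne_zero (pow_ne_zero 2 (hr0 k)) (hpiv k hk)
  · intro k i j hi hj hne
    have hk : k + 1 < n := by omega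
    rw [hBpn k (by omega), hG k i j hi hj]
    have hb := hbd k i j hi hj hne
    by_cases hc : k < i.1 ∧ k < j.1
    · have h1 : D (min i.1 j.1) ≤ D (k + 1) := hDmono _ _ (by omega) (by omega)
      have h2 := hDs k hk
      rw [hrsq k hk]
      have h3 := norm_add_le (geIter A k i j) (cpCor A r i j)
      have h4 := hcor i j
      nlinarith
    · have hm : min i.1 j.1 = k := by omega
      have hij : i ≠ j := by intro h; rw [h] at hm hne; simp at hm; omega
      rw [cpCor_off A r k i j hij hm, norm_mul, RCLike.norm_ofReal,
        abs_of_nonneg (by linarith [hr1 k])]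
      have hr := hr1 k
      calc r k * ‖geIter A k i j‖ ≤ r k * ((1 + ε k) * p k) :=
            mul_le_mul_of_nonneg_left hb (by linarith)
        _ ≤ r k * ((r k * (1 + δ k)) * p k) :=
            mul_le_mul_of_nonneg_left
              (mul_le_mul_of_nonneg_right (hrge k hk) (hp0 k)) (by linarith)
        _ = (1 + δ k) * (r k ^ 2 * p k) := by ring
  · intro k hk
    rw [hG k _ _ (by simp; omega) (by simp; omega)]
    have : r (n - 1) = 1 := by
      have : ¬ (n - 1 + 1 < n) := by omega
      simp only [hrdef, this, if_false]
    simp [cpCor, this]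
  · intro k i j hi hj
    rw [hG k i j hi hj, add_sub_cancel_left]
    exact hcor i j
end
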